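/- arXiv:1604.04225 — 2 statements merged into one kernel-verified Lean document; each statement's English description precedes it below -/
import Mathlib

section
/- Entropy Power Inequality: if X and Y are independent random vectors in ℝ^d with densities such that the Shannon entropies h(X), h(Y) and h(X+Y) exist (the defining integrals are well defined and finite), then N(X+Y) ≥ N(X) + N(Y), i.e., exp(2h(X+Y)/d) ≥ exp(2h(X)/d) + exp(2h(Y)/d). -/
open MeasureTheory ProbabilityTheory Real
open scoped ENNReal

noncomputable section
/-- The random vector `X` has density `f` with respect to Lebesgue measure on `ℝ^d`. -/
def HasDensityFn {Ω : Type*} [MeasurableSpace Ω] {d : ℕ}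
    (P : Measure Ω) (X : Ω → (Fin d → ℝ)) (f : (Fin d → ℝ) → ℝ) : Prop :=
  Measurable X ∧ Measurable f ∧ (∀ x, 0 ≤ f x) ∧
    Measure.map X P = volume.withDensity (fun x => ENNReal.ofReal (f x))

/-- Shannon (differential) entropy of a density `f` on `ℝ^d`: `h(f) = -∫ f log f`. -/
def shannonEntropy (d : ℕ) (f : (Fin d → ℝ) → ℝ) : ℝ :=
  -∫ x, f x * Real.log (f x)

/-- Entropy power `N(f) = exp(2 h(f) / d)`. -/
def entropyPower (d : ℕ) (f : (Fin d → ℝ) → ℝ) : ℝ :=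
  Real.exp (2 * shannonEntropy d f / d)

/-! ### Part 1: monotone transport from the standard Gaussian -/

/-- The standard Gaussian density. -/
def gph (s : ℝ) : ℝ := gaussianPDFReal 0 1 s

lemma gph_pos (s : ℝ) : 0 < gph s := gaussianPDFReal_pos 0 1 s one_ne_zero

lemma gph_cont : Continuous gph := by
  unfold gph
  rw [gaussianPDFReal_def]
  fun_prop

lemma gph_int : Integrable gph := integrable_gaussianPDFReal 0 1

/-- The standard Gaussian distribution function. -/
def gPh (s : ℝ) : ℝ := ∫ t in Set.Iic s, gph t

lemma gPh_sub (s t : ℝ) : gPh t - gPh s = ∫ u in s..t, gph u :=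
  intervalIntegral.integral_Iic_sub_Iic gph_int.integrableOn gph_int.integrableOn

lemma gPh_deriv (s : ℝ) : HasDerivAt gPh (gph s) s := by
  have h1 : gPh = fun t => (∫ u in (0 : ℝ)..t, gph u) + gPh 0 := by
    funext t; rw [← gPh_sub]; ring
  rw [h1]
  exact (intervalIntegral.integral_hasDerivAt_right gph_int.intervalIntegrable
    gph_cont.stronglyMeasurable.stronglyMeasurableAtFilter gph_cont.continuousAt).add_const _

lemma gPh_strictMono : StrictMono gPh :=
  strictMono_of_hasDerivAt_pos gPh_deriv gph_pos

lemma gPh_pos (s : ℝ) : 0 < gPh s := by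
  have h : 0 ≤ gPh (s - 1) := by
    unfold gPh; exact setIntegral_nonneg measurableSet_Iic (fun t _ => (gph_pos t).le)
  exact h.trans_lt (gPh_strictMono (by linarith))

lemma gPh_lt_one (s : ℝ) : gPh s < 1 := by
  have h : gPh (s + 1) ≤ 1 := by
    rw [← integral_gaussianPDFReal_eq_one 0 (v := 1) one_ne_zero]
    exact setIntegral_le_integral gph_int (Filter.Eventually.of_forall fun t => (gph_pos t).le)
  exact (gPh_strictMono (by linarith)).trans_le h

lemma exists_transport {M C δ : ℝ} {f : ℝ → ℝ} (hM : 0 < M) (hδ : 0 < δ) (hf : Measurable f)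
    (hb : ∀ x, |x| ≤ M → δ ≤ f x ∧ f x ≤ C) (h0 : ∀ x, M < |x| → f x = 0)
    (hfi : Integrable f) (h1 : ∫ x, f x = 1) :
    ∃ T : ℝ → ℝ, Continuous T ∧ StrictMono T ∧ (∀ s, |T s| ≤ M) ∧
      (∀ᵐ s, HasDerivAt T (gph s / f (T s)) s) ∧
      (gaussianReal 0 1).map T = volume.withDensity (fun x => ENNReal.ofReal (f x)) := by
  have hC : 0 < C := by
    have := hb 0 (by simpa using hM.le); linarith
  have hfnn : ∀ x, 0 ≤ f x := fun x => by
    rcases le_or_gt |x| M with h | h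
    · exact hδ.le.trans (hb x h).1
    · rw [h0 x h]
  have hii : ∀ x y, IntervalIntegrable f volume x y := fun x y => hfi.intervalIntegrable
  set F : ℝ → ℝ := fun x => ∫ t in (-M)..x, f t with hF
  have hsub : ∀ x y, F y - F x = ∫ t in x..y, f t := fun x y =>
    intervalIntegral.integral_interval_sub_left (hii _ _) (hii _ _)
  have hFM : F (-M) = 0 := by simp [hF]
  have hF1 : F M = 1 := by
    rw [hF, ← h1]
    simp only
    rw [intervalIntegral.integral_of_le (by linarith), ← integral_Icc_eq_integral_Ioc]
    apply setIntegral_eq_integral_of_forall_compl_eq_zero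
    intro x hx
    apply h0
    by_contra hc
    exact hx (abs_le.mp (not_lt.mp hc))
  have hlow : ∀ x y, -M ≤ x → x ≤ y → y ≤ M → δ * (y - x) ≤ F y - F x := by
    intro x y hx hxy hy
    rw [hsub]
    calc δ * (y - x) = ∫ t in x..y, δ := by simp; ring
      _ ≤ _ := by
        apply intervalIntegral.integral_mono_on hxy (by simp) (hii _ _)
        intro t ht
        exact (hb t (abs_le.mpr ⟨hx.trans ht.1, ht.2.trans hy⟩)).1
  have hfC : ∀ x, f x ≤ C := fun x => by
    rcases le_or_gt |x| M with h | h
    · exact (hb x h).2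
    · rw [h0 x h]; exact hC.le
  have hup : ∀ x y, |F y - F x| ≤ C * |y - x| := by
    intro x y
    rw [hsub, ← Real.norm_eq_abs]
    apply intervalIntegral.norm_integral_le_of_norm_le_const
    intro t _
    rw [Real.norm_of_nonneg (hfnn t)]; exact hfC t
  have hLip : LipschitzWith C.toNNReal F := by
    apply LipschitzWith.of_dist_le_mul
    intro x y
    rw [Real.dist_eq, Real.dist_eq, Real.coe_toNNReal _ hC.le]
    exact hup y x
  have hFmono : Monotone F := by
    intro x y hxy
    have := hsub x y
    have h2 : 0 ≤ ∫ t in x..y, f t := intervalIntegral.integral_nonneg hxy (fun t _ => hfnn t)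
    linarith
  have hex : ∀ u : ℝ, ∃ x, u ∈ Set.Ioo (0 : ℝ) 1 → x ∈ Set.Ioo (-M) M ∧ F x = u := by
    intro u
    by_cases hu : u ∈ Set.Ioo (0 : ℝ) 1
    · have := intermediate_value_Ioo (by linarith : -M ≤ M) hLip.continuous.continuousOn
      rw [hFM, hF1] at this
      obtain ⟨x, hx, hxu⟩ := this hu
      exact ⟨x, fun _ => ⟨hx, hxu⟩⟩
    · exact ⟨0, fun h => absurd h hu⟩
  choose G hG using hex
  have hGlip : ∀ u ∈ Set.Ioo (0 : ℝ) 1, ∀ v ∈ Set.Ioo (0 : ℝ) 1, |G u - G v| ≤ δ⁻¹ * |u - v| := by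
    intro u hu v hv
    obtain ⟨hu1, hu2⟩ := hG u hu
    obtain ⟨hv1, hv2⟩ := hG v hv
    rw [inv_mul_eq_div, le_div_iff₀ hδ]
    rcases le_total (G u) (G v) with h | h
    · have := hlow _ _ hu1.1.le h hv1.2.le
      rw [hu2, hv2] at this
      rw [abs_sub_comm, abs_of_nonneg (by linarith), abs_sub_comm]
      exact (by linarith : (G v - G u) * δ ≤ v - u).trans (le_abs_self _)
    · have := hlow _ _ hv1.1.le h hu1.2.le
      rw [hu2, hv2] at this
      rw [abs_of_nonneg (by linarith)]
      exact (by linarith : (G u - G v) * δ ≤ u - v).trans (le_abs_self _)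
  have hGc : ContinuousOn G (Set.Ioo 0 1) := by
    have : LipschitzOnWith (δ⁻¹).toNNReal G (Set.Ioo 0 1) := by
      apply LipschitzOnWith.of_dist_le_mul
      intro x hx y hy
      rw [Real.dist_eq, Real.dist_eq, Real.coe_toNNReal _ (by positivity)]
      exact hGlip x hx y hy
    exact this.continuousOn
  have hΦ : ∀ s, gPh s ∈ Set.Ioo (0 : ℝ) 1 := fun s => ⟨gPh_pos s, gPh_lt_one s⟩
  have hΦc : Continuous gPh := continuous_iff_continuousAt.2 fun s => (gPh_deriv s).continuousAt
  set T : ℝ → ℝ := fun s => G (gPh s) with hT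
  have hFT : ∀ s, F (T s) = gPh s := fun s => (hG _ (hΦ s)).2
  have hTM : ∀ s, T s ∈ Set.Ioo (-M) M := fun s => (hG _ (hΦ s)).1
  have hTM' : ∀ s, |T s| ≤ M := fun s => abs_le.mpr ⟨(hTM s).1.le, (hTM s).2.le⟩
  have hTc : Continuous T := hGc.comp_continuous hΦc hΦ
  have hTs : StrictMono T := by
    intro s t hst
    by_contra hc
    have := hFmono (not_lt.mp hc)
    rw [hFT, hFT] at this
    exact absurd (gPh_strictMono hst) (not_lt.mpr this)
  have hfT : ∀ s, 0 < f (T s) := fun s => hδ.trans_le (hb _ (hTM' s)).1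
  have hae := LocallyIntegrable.ae_hasDerivAt_integral hfi.locallyIntegrable
  obtain ⟨N, hNsub, hNm, hN0⟩ := exists_measurable_superset_of_null (ae_iff.mp hae)
  have hFN : volume (F '' N) = 0 := by
    have := hLip.hausdorffMeasure_image_le (d := 1) zero_le_one N
    rw [hausdorffMeasure_real, hN0] at this
    simpa using this
  have hA : volume (T ⁻¹' N) = 0 := by
    have hAm : MeasurableSet (T ⁻¹' N) := hTc.measurable hNm
    have hcv := lintegral_image_eq_lintegral_abs_deriv_mul hAm
      (fun x _ => (gPh_deriv x).hasDerivWithinAt) gPh_strictMono.injective.injOn (fun _ => 1)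
    have hsubs : gPh '' (T ⁻¹' N) ⊆ F '' N := by
      rintro _ ⟨s, hs, rfl⟩
      exact ⟨T s, hs, hFT s⟩
    rw [setLIntegral_measure_zero _ _ (measure_mono_null hsubs hFN), eq_comm,
      lintegral_eq_zero_iff (by
        exact ((gph_cont.abs.measurable).ennreal_ofReal).mul_const _)] at hcv
    by_contra hne
    have h3 : ∀ᵐ x ∂(volume.restrict (T ⁻¹' N)), False := by
      filter_upwards [hcv] with x hx
      have := gph_pos x
      simp at hx
      linarith
    rw [Filter.eventually_false_iff_eq_bot, ae_eq_bot, Measure.restrict_eq_zero] at h3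
    exact hne h3
  have hder : ∀ᵐ s, HasDerivAt T (gph s / f (T s)) s := by
    filter_upwards [measure_eq_zero_iff_ae_notMem.mp hA] with s hs
    have hs2 : HasDerivAt F (f (T s)) (T s) := by
      by_contra hc
      apply hs
      apply hNsub
      intro hcc
      exact hc (hcc (-M))
    have hnh : Set.Ioo (0 : ℝ) 1 ∈ nhds (gPh s) := Ioo_mem_nhds (hΦ s).1 (hΦ s).2
    have hGd : HasDerivAt G (f (T s))⁻¹ (gPh s) := by
      apply HasDerivAt.of_local_left_inverse (f := F) (hGc.continuousAt hnh) hs2 (hfT s).ne'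
      filter_upwards [hnh] with y hy using (hG y hy).2
    have := hGd.comp s (gPh_deriv s)
    rwa [inv_mul_eq_div] at this
  refine ⟨T, hTc, hTs, hTM', hder, ?_⟩
  have : IsProbabilityMeasure ((gaussianReal 0 1).map T) :=
    Measure.isProbabilityMeasure_map hTc.aemeasurable
  have : IsProbabilityMeasure (volume.withDensity (fun x => ENNReal.ofReal (f x))) := by
    constructor
    rw [withDensity_apply _ MeasurableSet.univ, Measure.restrict_univ,
      ← ofReal_integral_eq_lintegral_ofReal hfi (Filter.Eventually.of_forall hfnn), h1]
    simp
  apply Measure.eq_of_le_of_isProbabilityMeasure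
  rw [Measure.le_iff]
  intro B hB
  rw [Measure.map_apply hTc.measurable hB, withDensity_apply _ hB,
    gaussianReal_apply 0 one_ne_zero]
  obtain ⟨N2, hN2sub, hN2m, hN20⟩ := exists_measurable_superset_of_null (ae_iff.mp hder)
  have hSm : MeasurableSet (T ⁻¹' B \ N2) := (hTc.measurable hB).diff hN2m
  have hcv := lintegral_image_eq_lintegral_abs_deriv_mul hSm (f := T)
    (f' := fun s => gph s / f (T s))
    (fun x hx => by
      have : HasDerivAt T (gph x / f (T x)) x := by
        by_contra hc
        exact hx.2 (hN2sub hc)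
      exact this.hasDerivWithinAt) hTs.injective.injOn (fun x => ENNReal.ofReal (f x))
  have hcv2 : ∫⁻ x in T ⁻¹' B \ N2, ENNReal.ofReal |gph x / f (T x)| * ENNReal.ofReal (f (T x))
      = ∫⁻ x in T ⁻¹' B, gaussianPDF 0 1 x := by
    rw [setLIntegral_congr (sdiff_null_ae_eq_self hN20)]
    apply lintegral_congr
    intro x
    rw [← ENNReal.ofReal_mul (abs_nonneg _), abs_of_pos (div_pos (gph_pos x) (hfT x)),
      div_mul_cancel₀ _ (hfT x).ne']
    rfl
  rw [← hcv2, ← hcv]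
  apply lintegral_mono_set
  rintro _ ⟨x, hx, rfl⟩
  exact hx.1

/-! ### Part 2: the one-dimensional inequality for densities bounded below -/

lemma log_gph (s : ℝ) : Real.log (gph s) = Real.log (√(2 * π))⁻¹ + (-(1 / 2)) * s ^ 2 := by
  unfold gph
  rw [gaussianPDFReal_def]
  simp only [NNReal.coe_one, mul_one, sub_zero]
  rw [Real.log_mul (by positivity) (by positivity), Real.log_exp]
  ring

lemma int_log_gph : Integrable (fun s => Real.log (gph s)) (gaussianReal 0 1) := by
  simp_rw [log_gph]
  apply Integrable.add (integrable_const _)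
  apply Integrable.const_mul
  have := (memLp_id_gaussianReal (μ := 0) (v := 1) 2).integrable_sq
  simpa using this

lemma logmean {a b u v : ℝ} (ha : 0 < a) (hb : 0 < b) (hab : a ^ 2 + b ^ 2 = 1)
    (hu : 0 < u) (hv : 0 < v) :
    a ^ 2 * (Real.log u - Real.log a) + b ^ 2 * (Real.log v - Real.log b)
      ≤ Real.log (a * u + b * v) := by
  have h := strictConcaveOn_log_Ioi.concaveOn.2 (x := u / a) (y := v / b)
    (div_pos hu ha) (div_pos hv hb) (sq_nonneg a) (sq_nonneg b) hab
  simp only [smul_eq_mul] at h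
  rw [Real.log_div hu.ne' ha.ne', Real.log_div hv.ne' hb.ne'] at h
  have e : a ^ 2 * (u / a) + b ^ 2 * (v / b) = a * u + b * v := by field_simp
  rwa [e] at h

lemma integral_density {α : Type*} [MeasurableSpace α] {μ : Measure α} {f : α → ℝ}
    (hf : Measurable f) (hfnn : ∀ x, 0 ≤ f x) (k : α → ℝ) :
    ∫ x, k x ∂(μ.withDensity (fun x => ENNReal.ofReal (f x))) = ∫ x, f x * k x ∂μ := by
  rw [integral_withDensity_eq_integral_toReal_smul hf.ennreal_ofReal (by simp)]
  simp only [smul_eq_mul]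
  congr 1; funext x
  rw [ENNReal.toReal_ofReal (hfnn x)]

lemma core_1d {a b : ℝ} (ha : 0 < a) (hb : 0 < b) (hab : a ^ 2 + b ^ 2 = 1)
    {M C δ c : ℝ} {f g r : ℝ → ℝ} (hM : 0 < M) (hδ : 0 < δ) (hc : 0 < c)
    (hf : Measurable f) (hg : Measurable g) (hr : Measurable r)
    (hfb : ∀ x, |x| ≤ M → δ ≤ f x ∧ f x ≤ C) (hf0 : ∀ x, M < |x| → f x = 0)
    (hfi : Integrable f) (hf1 : ∫ x, f x = 1)
    (hgb : ∀ x, |x| ≤ M → δ ≤ g x ∧ g x ≤ C) (hg0 : ∀ x, M < |x| → g x = 0)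
    (hgi : Integrable g) (hg1 : ∫ x, g x = 1)
    (hrb : ∀ x, |x| ≤ 2 * M → c ≤ r x ∧ r x ≤ C) (hr0 : ∀ x, 2 * M < |x| → r x = 0)
    (hri : Integrable r) :
    ∫ p : ℝ × ℝ, f p.1 * g p.2 * Real.log (r (p.1 + p.2)) ≤
      Real.log (∫ x, r x) + a ^ 2 * (∫ x, f x * Real.log (f x))
        + b ^ 2 * (∫ x, g x * Real.log (g x)) + (a ^ 2 * Real.log a + b ^ 2 * Real.log b) := by
  obtain ⟨T, hTc, hTs, hTM, hTd, hTm⟩ := exists_transport hM hδ hf hfb hf0 hfi hf1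
  obtain ⟨U, hUc, hUs, hUM, hUd, hUm⟩ := exists_transport hM hδ hg hgb hg0 hgi hg1
  have nn : ∀ {k : ℝ → ℝ}, (∀ x, |x| ≤ M → δ ≤ k x ∧ k x ≤ C) → (∀ x, M < |x| → k x = 0) →
      ∀ x, 0 ≤ k x := by
    intro k h1 h2 x
    rcases le_or_gt |x| M with h | h
    · exact hδ.le.trans (h1 x h).1
    · rw [h2 x h]
  have hfnn := nn hfb hf0
  have hgnn := nn hgb hg0
  have hrnn : ∀ x, 0 ≤ r x := fun x => by
    rcases le_or_gt |x| (2 * M) with h | h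
    · exact hc.le.trans (hrb x h).1
    · rw [hr0 x h]
  set γ := gaussianReal 0 1 with hγ
  set γ2 := γ.prod γ with hγ2
  obtain ⟨θ, hθa, hθb⟩ : ∃ θ : ℝ, Real.cos θ = a ∧ Real.sin θ = b := by
    refine ⟨Real.arccos a, ?_, ?_⟩
    · exact Real.cos_arccos (by linarith) (by nlinarith)
    · rw [Real.sin_arccos, show 1 - a ^ 2 = b ^ 2 by linarith, Real.sqrt_sq hb.le]
  have hrot := IsGaussian.map_rotation_eq_self (μ := γ) (by simp [hγ]) θ
  set G1 : ℝ × ℝ → ℝ := fun q => -b * q.1 + a * q.2 with hG1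
  set G2 : ℝ × ℝ → ℝ := fun q => a * q.1 + b * q.2 with hG2
  have hG1m : Measurable G1 := by fun_prop
  have hG2m : Measurable G2 := by fun_prop
  have mprot : MeasurePreserving (fun q : ℝ × ℝ => (G2 q, G1 q)) γ2 γ2 := by
    refine ⟨hG2m.prodMk hG1m, ?_⟩
    convert hrot using 2
    funext q
    rw [ContinuousLinearMap.rotation_apply, hθa, hθb]
    simp [hG1, hG2]
  have mp1 : MeasurePreserving G1 γ2 γ := measurePreserving_snd.comp mprot
  have mp2 : MeasurePreserving G2 γ2 γ := measurePreserving_fst.comp mprot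
  have mpr : MeasurePreserving (fun q : ℝ × ℝ => q.2) γ2 γ := measurePreserving_snd
  have mpT : MeasurePreserving T γ (volume.withDensity fun x => ENNReal.ofReal (f x)) :=
    ⟨hTc.measurable, hTm⟩
  have mpU : MeasurePreserving U γ (volume.withDensity fun x => ENNReal.ofReal (g x)) :=
    ⟨hUc.measurable, hUm⟩
  have mpTU : MeasurePreserving (fun q => (T (G1 q), U (G2 q))) γ2
      ((volume.withDensity fun x => ENNReal.ofReal (f x)).prod
        (volume.withDensity fun x => ENNReal.ofReal (g x))) :=
    (mpT.prod mpU).comp ((Measure.measurePreserving_swap (μ := γ) (ν := γ)).comp mprot)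
  set Ψ : ℝ × ℝ → ℝ := fun q => T (G1 q) + U (G2 q) with hΨ
  have hΨm : Measurable Ψ := (hTc.measurable.comp hG1m).add (hUc.measurable.comp hG2m)
  have hΨM : ∀ q, |Ψ q| ≤ 2 * M := fun q =>
    (abs_add_le _ _).trans (by linarith [hTM (G1 q), hUM (G2 q)])
  have hlogr : Measurable (fun p : ℝ × ℝ => Real.log (r (p.1 + p.2))) := by fun_prop
  have hLHS : ∫ p : ℝ × ℝ, f p.1 * g p.2 * Real.log (r (p.1 + p.2))
      = ∫ q, Real.log (r (Ψ q)) ∂γ2 := by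
    have h1 := integral_map (μ := γ2) mpTU.measurable.aemeasurable
      (f := fun p : ℝ × ℝ => Real.log (r (p.1 + p.2))) hlogr.aestronglyMeasurable
    rw [mpTU.map_eq, prod_withDensity hf.ennreal_ofReal hg.ennreal_ofReal] at h1
    rw [← h1]
    have h2 : (fun z : ℝ × ℝ => ENNReal.ofReal (f z.1) * ENNReal.ofReal (g z.2))
        = fun z => ENNReal.ofReal (f z.1 * g z.2) := by
      funext z; rw [ENNReal.ofReal_mul (hfnn _)]
    rw [h2, integral_density (f := fun z : ℝ × ℝ => f z.1 * g z.2) (by fun_prop)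
      (fun z => mul_nonneg (hfnn _) (hgnn _))]
    rfl
  have blog : ∀ {c' x : ℝ}, 0 < c' → c' ≤ x ∧ x ≤ C → ‖Real.log x‖ ≤ |Real.log c'| + |Real.log C| := by
    intro c' x h0 h1
    have l1 := Real.log_le_log h0 h1.1
    have l2 := Real.log_le_log (h0.trans_le h1.1) h1.2
    rw [Real.norm_eq_abs, abs_le]
    constructor
    · linarith [neg_abs_le (Real.log c'), abs_nonneg (Real.log C)]
    · linarith [le_abs_self (Real.log C), abs_nonneg (Real.log c')]
  have irΨ : Integrable (fun q => Real.log (r (Ψ q))) γ2 :=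
    Integrable.of_bound (Measurable.aestronglyMeasurable (by fun_prop)) _ (Filter.Eventually.of_forall fun q =>
      blog hc (hrb _ (hΨM q)))
  have ifT : Integrable (fun s => Real.log (f (T s))) γ :=
    Integrable.of_bound (Measurable.aestronglyMeasurable (by fun_prop)) _ (Filter.Eventually.of_forall fun q =>
      blog hδ (hfb _ (hTM q)))
  have igU : Integrable (fun s => Real.log (g (U s))) γ :=
    Integrable.of_bound (Measurable.aestronglyMeasurable (by fun_prop)) _ (Filter.Eventually.of_forall fun q =>
      blog hδ (hgb _ (hUM q)))
  have eT : ∫ s, Real.log (f (T s)) ∂γ = ∫ x, f x * Real.log (f x) := by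
    rw [← integral_density hf hfnn, ← mpT.map_eq, integral_map hTc.aemeasurable]
    exact (by fun_prop : Measurable (fun x => Real.log (f x))).aestronglyMeasurable
  have eU : ∫ s, Real.log (g (U s)) ∂γ = ∫ x, g x * Real.log (g x) := by
    rw [← integral_density hg hgnn, ← mpU.map_eq, integral_map hUc.aemeasurable]
    exact (by fun_prop : Measurable (fun x => Real.log (g x))).aestronglyMeasurable
  set T' : ℝ → ℝ := fun s => gph s / f (T s) with hT'
  set U' : ℝ → ℝ := fun s => gph s / g (U s) with hU'
  have hfT : ∀ s, 0 < f (T s) := fun s => hδ.trans_le (hfb _ (hTM s)).1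
  have hgU : ∀ s, 0 < g (U s) := fun s => hδ.trans_le (hgb _ (hUM s)).1
  have hT'p : ∀ s, 0 < T' s := fun s => div_pos (gph_pos s) (hfT s)
  have hU'p : ∀ s, 0 < U' s := fun s => div_pos (gph_pos s) (hgU s)
  have hgphm : Measurable gph := gph_cont.measurable
  have hT'm : Measurable T' := by fun_prop
  have hU'm : Measurable U' := by fun_prop
  have lT : ∀ s, Real.log (T' s) = Real.log (gph s) - Real.log (f (T s)) := fun s =>
    Real.log_div (gph_pos s).ne' (hfT s).ne'
  have lU : ∀ s, Real.log (U' s) = Real.log (gph s) - Real.log (g (U s)) := fun s =>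
    Real.log_div (gph_pos s).ne' (hgU s).ne'
  set L := ∫ s, Real.log (gph s) ∂γ with hL
  have ilT : Integrable (fun s => Real.log (T' s)) γ := by
    simp_rw [lT]; exact int_log_gph.sub ifT
  have ilU : Integrable (fun s => Real.log (U' s)) γ := by
    simp_rw [lU]; exact int_log_gph.sub igU
  have elT : ∫ s, Real.log (T' s) ∂γ = L - ∫ x, f x * Real.log (f x) := by
    simp_rw [lT]; rw [integral_sub int_log_gph ifT, eT]
  have elU : ∫ s, Real.log (U' s) ∂γ = L - ∫ x, g x * Real.log (g x) := by
    simp_rw [lU]; rw [integral_sub int_log_gph igU, eU]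
  have comp1 : ∀ {G : ℝ × ℝ → ℝ} {k : ℝ → ℝ}, MeasurePreserving G γ2 γ → Measurable k →
      ∫ q, k (G q) ∂γ2 = ∫ s, k s ∂γ := by
    intro G k hG hk
    rw [← hG.map_eq, integral_map hG.measurable.aemeasurable hk.aestronglyMeasurable]
  set J : ℝ × ℝ → ℝ := fun q => a * T' (G1 q) + b * U' (G2 q) with hJ
  have hJp : ∀ q, 0 < J q := fun q =>
    add_pos (mul_pos ha (hT'p _)) (mul_pos hb (hU'p _))
  have hJm : Measurable J := by fun_prop
  set W : ℝ × ℝ → ℝ := fun q => r (Ψ q) * J q / gph q.2 with hW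
  have hWm : Measurable W := by fun_prop
  have hrΨ : ∀ q, 0 < r (Ψ q) := fun q => hc.trans_le (hrb _ (hΨM q)).1
  have hWp : ∀ q, 0 < W q := fun q => div_pos (mul_pos (hrΨ q) (hJp q)) (gph_pos _)
  have hdae : ∀ᵐ q ∂γ2, HasDerivAt T (T' (G1 q)) (G1 q) ∧ HasDerivAt U (U' (G2 q)) (G2 q) := by
    have h1 := mp1.quasiMeasurePreserving.ae
      ((gaussianReal_absolutelyContinuous 0 one_ne_zero).ae_le hTd)
    have h2 := mp2.quasiMeasurePreserving.ae
      ((gaussianReal_absolutelyContinuous 0 one_ne_zero).ae_le hUd)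
    filter_upwards [h1, h2] with q h3 h4 using ⟨h3, h4⟩
  have hWl : ∫⁻ q, ENNReal.ofReal (W q) ∂γ2 ≤ ENNReal.ofReal (∫ x, r x) := by
    rw [lintegral_prod _ (by fun_prop)]
    have key : ∀ᵐ R ∂γ, ∫⁻ s, ENNReal.ofReal (W (R, s)) ∂γ ≤ ENNReal.ofReal (∫ x, r x) := by
      filter_upwards [Measure.ae_ae_of_ae_prod hdae] with R hR
      have hR' : ∀ᵐ s, HasDerivAt T (T' (G1 (R, s))) (G1 (R, s)) ∧
          HasDerivAt U (U' (G2 (R, s))) (G2 (R, s)) :=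
        (gaussianReal_absolutelyContinuous' 0 one_ne_zero).ae_le hR
      obtain ⟨N, hNsub, hNm, hN0⟩ := exists_measurable_superset_of_null (ae_iff.mp hR')
      have hmono : StrictMono (fun s => Ψ (R, s)) := by
        intro s t hst
        simp only [hΨ, hG1, hG2]
        have h1 := mul_lt_mul_of_pos_left hst ha
        have h2 := mul_lt_mul_of_pos_left hst hb
        exact add_lt_add (hTs (by linarith)) (hUs (by linarith))
      have hcv := lintegral_image_eq_lintegral_abs_deriv_mul hNm.compl (f := fun s => Ψ (R, s))
        (f' := fun s => J (R, s))
        (fun s hs => by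
          have hs' : HasDerivAt T (T' (G1 (R, s))) (G1 (R, s)) ∧
              HasDerivAt U (U' (G2 (R, s))) (G2 (R, s)) := by
            by_contra hcc
            exact hs (hNsub hcc)
          have d1 : HasDerivAt (fun s => G1 (R, s)) a s := by
            simpa [hG1] using ((hasDerivAt_id s).const_mul a).const_add (-b * R)
          have d2 : HasDerivAt (fun s => G2 (R, s)) b s := by
            simpa [hG2] using ((hasDerivAt_id s).const_mul b).const_add (a * R)
          have := (hs'.1.comp s d1).add (hs'.2.comp s d2)
          simp only [hJ]
          rw [mul_comm a, mul_comm b]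
          exact this.hasDerivWithinAt) hmono.injective.injOn (fun x => ENNReal.ofReal (r x))
      have e1 : ∫⁻ s, ENNReal.ofReal (W (R, s)) ∂γ
          = ∫⁻ s, ENNReal.ofReal |J (R, s)| * ENNReal.ofReal (r (Ψ (R, s))) := by
        rw [hγ, gaussianReal_of_var_ne_zero 0 one_ne_zero,
          lintegral_withDensity_eq_lintegral_mul _ (measurable_gaussianPDF 0 1)
            (by fun_prop)]
        apply lintegral_congr
        intro s
        simp only [Pi.mul_apply]
        rw [← ENNReal.ofReal_mul (abs_nonneg _), abs_of_pos (hJp _)]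
        change ENNReal.ofReal (gph s) * _ = _
        rw [← ENNReal.ofReal_mul (gph_pos _).le]
        congr 1
        simp only [hW]
        field_simp [(gph_pos s).ne']
      have e2 : ∫⁻ s, ENNReal.ofReal |J (R, s)| * ENNReal.ofReal (r (Ψ (R, s)))
          = ∫⁻ s in Nᶜ, ENNReal.ofReal |J (R, s)| * ENNReal.ofReal (r (Ψ (R, s))) := by
        rw [← setLIntegral_univ]
        apply setLIntegral_congr
        refine (Filter.EventuallyEq.symm ?_)
        rw [ae_eq_univ, compl_compl]
        exact hN0
      rw [e1, e2, ← hcv, ofReal_integral_eq_lintegral_ofReal hri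
        (Filter.Eventually.of_forall hrnn)]
      exact setLIntegral_le_lintegral _ _
    calc ∫⁻ R, ∫⁻ s, ENNReal.ofReal (W (R, s)) ∂γ ∂γ
        ≤ ∫⁻ R, ENNReal.ofReal (∫ x, r x) ∂γ := lintegral_mono_ae key
      _ = _ := by simp
  have hWi : Integrable W γ2 := by
    refine ⟨hWm.aestronglyMeasurable, ?_⟩
    rw [hasFiniteIntegral_iff_ofReal (Filter.Eventually.of_forall fun q => (hWp q).le)]
    exact hWl.trans_lt ENNReal.ofReal_lt_top
  have hρ0 : 0 ≤ ∫ x, r x := integral_nonneg hrnn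
  have hWle : ∫ q, W q ∂γ2 ≤ ∫ x, r x := by
    rw [← ofReal_integral_eq_lintegral_ofReal hWi
      (Filter.Eventually.of_forall fun q => (hWp q).le)] at hWl
    exact (ENNReal.ofReal_le_ofReal_iff hρ0).mp hWl
  have hρ : 0 < ∫ x, r x := by
    refine lt_of_lt_of_le ?_ hWle
    rw [integral_pos_iff_support_of_nonneg (fun q => (hWp q).le) hWi]
    have : Function.support W = Set.univ := by
      ext q; simp [(hWp q).ne']
    rw [this]; simp
  set ρ := ∫ x, r x with hρd
  have hpt : ∀ q, a ^ 2 * (Real.log (T' (G1 q)) - Real.log a)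
      + b ^ 2 * (Real.log (U' (G2 q)) - Real.log b) + Real.log (r (Ψ q)) - Real.log (gph q.2)
      ≤ W q / ρ + (Real.log ρ - 1) := by
    intro q
    have h1 := logmean ha hb hab (hT'p (G1 q)) (hU'p (G2 q))
    have h2 : Real.log (W q) = Real.log (r (Ψ q)) + Real.log (J q) - Real.log (gph q.2) := by
      simp only [hW]
      rw [Real.log_div (mul_pos (hrΨ q) (hJp q)).ne' (gph_pos _).ne',
        Real.log_mul (hrΨ q).ne' (hJp q).ne']
    have h3 := Real.log_le_sub_one_of_pos (div_pos (hWp q) hρ)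
    rw [Real.log_div (hWp q).ne' hρ.ne'] at h3
    have h4 : Real.log (J q) = Real.log (a * T' (G1 q) + b * U' (G2 q)) := rfl
    linarith
  have mlT : Measurable fun s => Real.log (T' s) := by fun_prop
  have mlU : Measurable fun s => Real.log (U' s) := by fun_prop
  have mlg : Measurable fun s => Real.log (gph s) := by fun_prop
  have i1 : Integrable (fun q => Real.log (T' (G1 q))) γ2 := mp1.integrable_comp_of_integrable ilT
  have i2 : Integrable (fun q => Real.log (U' (G2 q))) γ2 := mp2.integrable_comp_of_integrable ilU
  have i3 : Integrable (fun q : ℝ × ℝ => Real.log (gph q.2)) γ2 :=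
    mpr.integrable_comp_of_integrable int_log_gph
  have j1 : Integrable (fun q => a ^ 2 * (Real.log (T' (G1 q)) - Real.log a)) γ2 :=
    (i1.sub (integrable_const _)).const_mul _
  have j2 : Integrable (fun q => b ^ 2 * (Real.log (U' (G2 q)) - Real.log b)) γ2 :=
    (i2.sub (integrable_const _)).const_mul _
  have hineq := integral_mono (((j1.add j2).add irΨ).sub i3)
    ((hWi.div_const ρ).add (integrable_const (Real.log ρ - 1))) hpt
  have k1 : ∫ q, a ^ 2 * (Real.log (T' (G1 q)) - Real.log a) ∂γ2
      = a ^ 2 * (L - (∫ x, f x * Real.log (f x)) - Real.log a) := by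
    rw [integral_const_mul, integral_sub i1 (integrable_const _), comp1 mp1 mlT, elT]
    simp
  have k2 : ∫ q, b ^ 2 * (Real.log (U' (G2 q)) - Real.log b) ∂γ2
      = b ^ 2 * (L - (∫ x, g x * Real.log (g x)) - Real.log b) := by
    rw [integral_const_mul, integral_sub i2 (integrable_const _), comp1 mp2 mlU, elU]
    simp
  have k3 : ∫ q : ℝ × ℝ, Real.log (gph q.2) ∂γ2 = L := comp1 mpr mlg
  have e1 := integral_sub ((j1.add j2).add irΨ) i3
  have e2 := integral_add (j1.add j2) irΨ
  have e3 := integral_add j1 j2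
  have e4 := integral_add (hWi.div_const ρ) (integrable_const (μ := γ2) (Real.log ρ - 1))
  have e5 : ∫ q, W q / ρ ∂γ2 ≤ 1 := by
    rw [integral_div]; exact (div_le_one hρ).mpr hWle
  have e6 : ∫ q : ℝ × ℝ, (Real.log ρ - 1) ∂γ2 = Real.log ρ - 1 := by simp
  simp only [Pi.add_apply, Pi.sub_apply] at hineq e1 e2 e3 e4
  rw [hLHS]
  rw [e1, e2, e3, e4, k1, k2, k3, e6] at hineq
  have hLL : a ^ 2 * L + b ^ 2 * L = L := by rw [← add_mul, hab, one_mul]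
  linarith

/-! ### Part 3: the dual inequality for bounded densities with bounded support -/

/-- The dual (unnormalized) form of the entropy inequality on `E`, with dimension `D`. -/
def LiebEPI (a b : ℝ) (E : Type) [NormedAddCommGroup E] [MeasureSpace E] (D : ℝ) : Prop :=
  ∀ (M C c : ℝ) (f g r : E → ℝ), 0 < M → 0 < c → Measurable f → Measurable g → Measurable r →
    (∀ x, 0 ≤ f x ∧ f x ≤ C) → (∀ x, M < ‖x‖ → f x = 0) →
    (∀ x, 0 ≤ g x ∧ g x ≤ C) → (∀ x, M < ‖x‖ → g x = 0) →
    (∀ x, ‖x‖ ≤ 2 * M → c ≤ r x ∧ r x ≤ C) → (∀ x, 2 * M < ‖x‖ → r x = 0) →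
    ∫ p : E × E, f p.1 * g p.2 * Real.log (r (p.1 + p.2)) ≤
      (∫ x, f x) * (∫ x, g x) * Real.log (∫ x, r x)
      + a ^ 2 * ((∫ x, g x) * (∫ x, f x * Real.log (f x))
          - (∫ x, g x) * ((∫ x, f x) * Real.log (∫ x, f x)))
      + b ^ 2 * ((∫ x, f x) * (∫ x, g x * Real.log (g x))
          - (∫ x, f x) * ((∫ x, g x) * Real.log (∫ x, g x)))
      + (∫ x, f x) * (∫ x, g x) * (D * (a ^ 2 * Real.log a + b ^ 2 * Real.log b))

section aux

variable {E : Type} [NormedAddCommGroup E] [MeasureSpace E] [OpensMeasurableSpace E]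
  [ProperSpace E] [IsFiniteMeasureOnCompacts (volume : Measure E)]

lemma int_bdd {M B : ℝ} {k : E → ℝ} (hk : Measurable k) (hb : ∀ x, ‖k x‖ ≤ B)
    (h0 : ∀ x, M < ‖x‖ → k x = 0) : Integrable k := by
  have hs : Function.support k ⊆ Metric.closedBall 0 M := by
    intro x hx
    rw [mem_closedBall_zero_iff]
    by_contra hc
    exact hx (h0 x (not_le.mp hc))
  rw [← integrableOn_iff_integrable_of_support_subset hs]
  have : volume (Metric.closedBall (0 : E) M) < ∞ := (isCompact_closedBall 0 M).measure_lt_top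
  exact IntegrableOn.of_bound this hk.aestronglyMeasurable B
    (Filter.Eventually.of_forall hb)

lemma dct_bdd {M B : ℝ} {k : ℕ → E → ℝ} {k' : E → ℝ} (hk : ∀ n, Measurable (k n))
    (hb : ∀ n x, ‖k n x‖ ≤ B) (h0 : ∀ n x, M < ‖x‖ → k n x = 0)
    (hl : ∀ x, Filter.Tendsto (fun n => k n x) Filter.atTop (nhds (k' x))) :
    Filter.Tendsto (fun n => ∫ x, k n x) Filter.atTop (nhds (∫ x, k' x)) := by
  have hB : 0 ≤ B := (norm_nonneg _).trans (hb 0 0)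
  apply tendsto_integral_of_dominated_convergence
    ((Metric.closedBall (0 : E) M).indicator (fun _ => B))
    (fun n => (hk n).aestronglyMeasurable)
  · apply int_bdd (M := M) (B := B)
    · exact measurable_const.indicator Metric.isClosed_closedBall.measurableSet
    · intro x
      by_cases h : x ∈ Metric.closedBall (0 : E) M
      · rw [Set.indicator_of_mem h, Real.norm_of_nonneg hB]
      · rw [Set.indicator_of_notMem h]; simpa using hB
    · intro x hx
      rw [Set.indicator_of_notMem]
      rw [mem_closedBall_zero_iff]; exact not_le.mpr hx
  · intro n
    apply Filter.Eventually.of_forall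
    intro x
    by_cases h : x ∈ Metric.closedBall (0 : E) M
    · rw [Set.indicator_of_mem h]; exact hb n x
    · rw [Set.indicator_of_notMem h, h0 n x]; · simp
      rw [mem_closedBall_zero_iff] at h; exact not_le.mp h
  · exact Filter.Eventually.of_forall hl

end aux

lemma bdd_mul_log (C : ℝ) : ∃ B, ∀ t, 0 ≤ t ∧ t ≤ C → ‖t * Real.log t‖ ≤ B := by
  obtain ⟨B, hB⟩ := isCompact_Icc.exists_bound_of_continuousOn (s := Set.Icc 0 C)
    Real.continuous_mul_log.continuousOn
  exact ⟨B, fun t ht => hB t ht⟩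

lemma bdd_log {c C x : ℝ} (h0 : 0 < c) (h1 : c ≤ x ∧ x ≤ C) :
    ‖Real.log x‖ ≤ |Real.log c| + |Real.log C| := by
  have l1 := Real.log_le_log h0 h1.1
  have l2 := Real.log_le_log (h0.trans_le h1.1) h1.2
  rw [Real.norm_eq_abs, abs_le]
  constructor
  · linarith [neg_abs_le (Real.log c), abs_nonneg (Real.log C)]
  · linarith [le_abs_self (Real.log C), abs_nonneg (Real.log c)]

lemma ent_scale {α M C : ℝ} {f : ℝ → ℝ} (hα : 0 < α) (hf : Measurable f)
    (hfb : ∀ x, 0 ≤ f x ∧ f x ≤ C) (hf0 : ∀ x, M < ‖x‖ → f x = 0) (h1 : ∫ x, f x = α) :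
    ∫ x, f x / α * Real.log (f x / α) = (∫ x, f x * Real.log (f x)) / α - Real.log α := by
  have hfi : Integrable f := int_bdd hf (B := C)
    (fun x => by rw [Real.norm_of_nonneg (hfb x).1]; exact (hfb x).2) hf0
  obtain ⟨B, hB⟩ := bdd_mul_log C
  have hfl : Integrable (fun x => f x * Real.log (f x)) := int_bdd (by fun_prop)
    (fun x => hB _ (hfb x)) (fun x hx => by rw [hf0 x hx]; simp)
  have h2 : ∀ x, f x / α * Real.log (f x / α)
      = f x * Real.log (f x) / α - f x * (Real.log α / α) := by
    intro x
    by_cases h : f x = 0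
    · simp [h]
    · rw [Real.log_div h hα.ne']; ring
  simp_rw [h2]
  rw [integral_sub (hfl.div_const _) (hfi.mul_const _), integral_div, integral_mul_const, h1]
  field_simp

lemma lieb_1d_low {a b : ℝ} (ha : 0 < a) (hb : 0 < b) (hab : a ^ 2 + b ^ 2 = 1)
    {M C δ c : ℝ} {f g r : ℝ → ℝ} (hM : 0 < M) (hδ : 0 < δ) (hc : 0 < c)
    (hf : Measurable f) (hg : Measurable g) (hr : Measurable r)
    (hfb : ∀ x, |x| ≤ M → δ ≤ f x ∧ f x ≤ C) (hf0 : ∀ x, M < |x| → f x = 0)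
    (hgb : ∀ x, |x| ≤ M → δ ≤ g x ∧ g x ≤ C) (hg0 : ∀ x, M < |x| → g x = 0)
    (hrb : ∀ x, |x| ≤ 2 * M → c ≤ r x ∧ r x ≤ C) (hr0 : ∀ x, 2 * M < |x| → r x = 0) :
    ∫ p : ℝ × ℝ, f p.1 * g p.2 * Real.log (r (p.1 + p.2)) ≤
      (∫ x, f x) * (∫ x, g x) * Real.log (∫ x, r x)
      + a ^ 2 * ((∫ x, g x) * (∫ x, f x * Real.log (f x))
          - (∫ x, g x) * ((∫ x, f x) * Real.log (∫ x, f x)))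
      + b ^ 2 * ((∫ x, f x) * (∫ x, g x * Real.log (g x))
          - (∫ x, f x) * ((∫ x, g x) * Real.log (∫ x, g x)))
      + (∫ x, f x) * (∫ x, g x) * (1 * (a ^ 2 * Real.log a + b ^ 2 * Real.log b)) := by
  have hC : 0 < C := by
    have := hfb 0 (by simpa using hM.le); linarith
  have nn : ∀ {k : ℝ → ℝ}, (∀ x, |x| ≤ M → δ ≤ k x ∧ k x ≤ C) → (∀ x, M < |x| → k x = 0) →
      ∀ x, 0 ≤ k x ∧ k x ≤ C := by
    intro k h1 h2 x
    rcases le_or_gt |x| M with h | h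
    · exact ⟨hδ.le.trans (h1 x h).1, (h1 x h).2⟩
    · rw [h2 x h]; exact ⟨le_rfl, hC.le⟩
  have hfn := nn hfb hf0
  have hgn := nn hgb hg0
  have hrn : ∀ x, 0 ≤ r x ∧ r x ≤ C := fun x => by
    rcases le_or_gt |x| (2 * M) with h | h
    · exact ⟨hc.le.trans (hrb x h).1, (hrb x h).2⟩
    · rw [hr0 x h]; exact ⟨le_rfl, hC.le⟩
  have ii : ∀ {k : ℝ → ℝ} {M' : ℝ}, Measurable k → (∀ x, 0 ≤ k x ∧ k x ≤ C) →
      (∀ x, M' < |x| → k x = 0) → Integrable k := by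
    intro k M' h1 h2 h3
    exact int_bdd h1 (B := C) (fun x => by rw [Real.norm_of_nonneg (h2 x).1]; exact (h2 x).2) h3
  have hfi := ii hf hfn hf0
  have hgi := ii hg hgn hg0
  have hri := ii hr hrn hr0
  have pos : ∀ {k : ℝ → ℝ}, (∀ x, |x| ≤ M → δ ≤ k x ∧ k x ≤ C) → (∀ x, 0 ≤ k x ∧ k x ≤ C) →
      Integrable k → 0 < ∫ x, k x := by
    intro k h1 h2 h3
    rw [integral_pos_iff_support_of_nonneg (fun x => (h2 x).1) h3]
    have : Set.Icc (-M) M ⊆ Function.support k := by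
      intro x hx
      exact (hδ.trans_le (h1 x (abs_le.mpr hx)).1).ne'
    refine lt_of_lt_of_le ?_ (measure_mono this)
    rw [Real.volume_Icc]
    simp; linarith
  have hα := pos hfb hfn hfi
  have hβ := pos hgb hgn hgi
  set α := ∫ x, f x with hαd
  set β := ∫ x, g x with hβd
  have hK : ∃ K, 0 < K ∧ C / α ≤ K ∧ C / β ≤ K ∧ C ≤ K :=
    ⟨max (C / α) (max (C / β) C), by positivity, by simp, by simp, by simp⟩
  obtain ⟨K, hK0, hK1, hK2, hK3⟩ := hK
  have key := core_1d ha hb hab (M := M) (C := K) (δ := min (δ / α) (δ / β)) (c := c)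
    (f := fun x => f x / α) (g := fun x => g x / β) (r := r) hM (by positivity) hc
    (by fun_prop) (by fun_prop) hr
    (fun x hx => ⟨(min_le_left _ _).trans (by gcongr; exact (hfb x hx).1),
      le_trans (by gcongr; exact (hfb x hx).2) hK1⟩)
    (fun x hx => by simp [hf0 x hx]) (hfi.div_const _)
    (by rw [integral_div]; exact div_self hα.ne')
    (fun x hx => ⟨(min_le_right _ _).trans (by gcongr; exact (hgb x hx).1),
      le_trans (by gcongr; exact (hgb x hx).2) hK2⟩)
    (fun x hx => by simp [hg0 x hx]) (hgi.div_const _)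
    (by rw [integral_div]; exact div_self hβ.ne')
    (fun x hx => ⟨(hrb x hx).1, (hrb x hx).2.trans hK3⟩) hr0 hri
  rw [ent_scale hα hf hfn hf0 hαd.symm, ent_scale hβ hg hgn hg0 hβd.symm] at key
  have e : ∫ p : ℝ × ℝ, f p.1 / α * (g p.2 / β) * Real.log (r (p.1 + p.2))
      = (∫ p : ℝ × ℝ, f p.1 * g p.2 * Real.log (r (p.1 + p.2))) / (α * β) := by
    rw [← integral_div]
    congr 1; funext p
    field_simp
  rw [e, div_le_iff₀ (by positivity)] at key
  refine key.trans (le_of_eq ?_)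
  field_simp

lemma lieb_1d {a b : ℝ} (ha : 0 < a) (hb : 0 < b) (hab : a ^ 2 + b ^ 2 = 1) :
    LiebEPI a b ℝ 1 := by
  intro M C c f g r hM hc hf hg hr hfb hf0 hgb hg0 hrb hr0
  have hC : 0 < C := by
    have := hrb 0 (by simp [hM.le]); linarith
  set S : Set ℝ := Metric.closedBall 0 M with hS
  have hSm : MeasurableSet S := Metric.isClosed_closedBall.measurableSet
  set ε : ℕ → ℝ := fun n => 1 / ((n : ℝ) + 1) with hε
  have hε0 : ∀ n, 0 < ε n := fun n => by positivity
  have hε1 : ∀ n, ε n ≤ 1 := fun n => by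
    rw [hε]; simp only; rw [div_le_one (by positivity)]; linarith [(Nat.cast_nonneg n : (0:ℝ) ≤ n)]
  have hεl : Filter.Tendsto ε Filter.atTop (nhds 0) := tendsto_one_div_add_atTop_nhds_zero_nat
  set ap : (ℝ → ℝ) → ℕ → ℝ → ℝ := fun k n x => k x + S.indicator (fun _ => ε n) x with hap
  have apm : ∀ {k : ℝ → ℝ}, Measurable k → ∀ n, Measurable (ap k n) := fun hk n =>
    hk.add (measurable_const.indicator hSm)
  have ap_in : ∀ (k : ℝ → ℝ) n x, |x| ≤ M → ap k n x = k x + ε n := by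
    intro k n x hx
    simp only [hap]
    rw [Set.indicator_of_mem]
    rw [hS, mem_closedBall_zero_iff]; exact hx
  have ap_out : ∀ {k : ℝ → ℝ}, (∀ x, M < ‖x‖ → k x = 0) → ∀ n x, M < |x| → ap k n x = 0 := by
    intro k hk n x hx
    simp only [hap]
    rw [Set.indicator_of_notMem, hk x hx, add_zero]
    rw [hS, mem_closedBall_zero_iff]; exact not_le.mpr hx
  have apl : ∀ (k : ℝ → ℝ) x, Filter.Tendsto (fun n => ap k n x) Filter.atTop (nhds (k x)) := by
    intro k x
    by_cases h : x ∈ S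
    · simp only [hap, Set.indicator_of_mem h]
      simpa using hεl.const_add (k x)
    · simp only [hap, Set.indicator_of_notMem h, add_zero]
      exact tendsto_const_nhds
  have apb : ∀ {k : ℝ → ℝ}, (∀ x, 0 ≤ k x ∧ k x ≤ C) → ∀ n x, |x| ≤ M →
      ε n ≤ ap k n x ∧ ap k n x ≤ C + 1 := by
    intro k hk n x hx
    rw [ap_in k n x hx]
    constructor <;> linarith [(hk x).1, (hk x).2, hε1 n]
  have apb' : ∀ {k : ℝ → ℝ}, (∀ x, 0 ≤ k x ∧ k x ≤ C) → (∀ x, M < ‖x‖ → k x = 0) → ∀ n x,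
      0 ≤ ap k n x ∧ ap k n x ≤ C + 1 := by
    intro k hk hk0 n x
    rcases le_or_gt |x| M with h | h
    · exact ⟨(hε0 n).le.trans (apb hk n x h).1, (apb hk n x h).2⟩
    · rw [ap_out hk0 n x h]; exact ⟨le_rfl, by linarith⟩
  have key := fun n => lieb_1d_low ha hb hab (M := M) (C := C + 1) (δ := ε n) (c := c)
    (f := ap f n) (g := ap g n) (r := r) hM (hε0 n) hc (apm hf n) (apm hg n) hr
    (apb hfb n) (ap_out hf0 n) (apb hgb n) (ap_out hg0 n)
    (fun x hx => ⟨(hrb x hx).1, (hrb x hx).2.trans (by linarith)⟩) hr0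
  have lim1 : ∀ {k : ℝ → ℝ}, Measurable k → (∀ x, 0 ≤ k x ∧ k x ≤ C) → (∀ x, M < ‖x‖ → k x = 0) →
      Filter.Tendsto (fun n => ∫ x, ap k n x) Filter.atTop (nhds (∫ x, k x)) := by
    intro k hk hkb hk0
    apply dct_bdd (M := M) (B := C + 1) (apm hk) _ (ap_out hk0) (apl k)
    intro n x
    rw [Real.norm_of_nonneg (apb' hkb hk0 n x).1]
    exact (apb' hkb hk0 n x).2
  have lim2 : ∀ {k : ℝ → ℝ}, Measurable k → (∀ x, 0 ≤ k x ∧ k x ≤ C) → (∀ x, M < ‖x‖ → k x = 0) →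
      Filter.Tendsto (fun n => ∫ x, ap k n x * Real.log (ap k n x)) Filter.atTop
        (nhds (∫ x, k x * Real.log (k x))) := by
    intro k hk hkb hk0
    obtain ⟨B, hB⟩ := bdd_mul_log (C + 1)
    apply dct_bdd (M := M) (B := B)
    · intro n
      have := apm hk n
      fun_prop
    · exact fun n x => hB _ (apb' hkb hk0 n x)
    · intro n x hx
      rw [ap_out hk0 n x hx]; simp
    · intro x
      exact (Real.continuous_mul_log.tendsto (k x)).comp (apl k x)
  have lim3 : Filter.Tendsto (fun n => ∫ p : ℝ × ℝ, ap f n p.1 * ap g n p.2 *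
      Real.log (r (p.1 + p.2))) Filter.atTop
      (nhds (∫ p : ℝ × ℝ, f p.1 * g p.2 * Real.log (r (p.1 + p.2)))) := by
    apply dct_bdd (M := M) (B := (C + 1) * (C + 1) * (|Real.log c| + |Real.log C|))
    · intro n
      have h1 := apm hf n
      have h2 := apm hg n
      fun_prop
    · intro n p
      rcases le_or_gt |p.1| M with h | h
      · rcases le_or_gt |p.2| M with h' | h'
        · rw [norm_mul, norm_mul]
          have h1 := apb' hfb hf0 n p.1
          have h2 := apb' hgb hg0 n p.2
          rw [Real.norm_of_nonneg h1.1, Real.norm_of_nonneg h2.1]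
          gcongr
          · linarith
          · exact h1.2
          · exact h2.2
          · exact bdd_log hc (hrb _ ((norm_add_le _ _).trans (by
              rw [Real.norm_eq_abs, Real.norm_eq_abs]; linarith)))
        · rw [ap_out hg0 n _ h']; simp; positivity
      · rw [ap_out hf0 n _ h]; simp; positivity
    · intro n p hp
      rw [Prod.norm_def, lt_max_iff] at hp
      rcases hp with h | h
      · rw [ap_out hf0 n _ h]; simp
      · rw [ap_out hg0 n _ h]; simp
    · intro p
      exact ((apl f p.1).mul (apl g p.2)).mul_const _
  have lf := lim1 hf hfb hf0
  have lg := lim1 hg hgb hg0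
  have lfl := (Real.continuous_mul_log.tendsto (∫ x, f x)).comp lf
  have lgl := (Real.continuous_mul_log.tendsto (∫ x, g x)).comp lg
  refine le_of_tendsto_of_tendsto' lim3 ?_ key
  exact ((((lf.mul lg).mul_const _).add
    (((lg.mul (lim2 hf hfb hf0)).sub (lg.mul lfl)).const_mul _)).add
    (((lf.mul (lim2 hg hgb hg0)).sub (lf.mul lgl)).const_mul _)).add ((lf.mul lg).mul_const _)

/-! ### Part 4: tensorization -/

lemma mp_shuffle {E F : Type} [MeasureSpace E] [MeasureSpace F]
    [SigmaFinite (volume : Measure E)] [SigmaFinite (volume : Measure F)] :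
    MeasurePreserving (fun q : (E × E) × (F × F) => ((q.1.1, q.2.1), (q.1.2, q.2.2)))
      volume volume := by
  have s1 : MeasurePreserving (MeasurableEquiv.prodAssoc : (E × E) × (F × F) ≃ᵐ E × E × F × F)
    volume volume := volume_preserving_prodAssoc
  have s2 : MeasurePreserving (MeasurableEquiv.prodAssoc : (E × F) × F ≃ᵐ E × F × F)
    volume volume := volume_preserving_prodAssoc
  have s3 : MeasurePreserving (MeasurableEquiv.prodAssoc : (F × E) × F ≃ᵐ F × E × F)
    volume volume := volume_preserving_prodAssoc
  have s4 : MeasurePreserving (MeasurableEquiv.prodAssoc : (E × F) × (E × F) ≃ᵐ E × F × E × F)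
    volume volume := volume_preserving_prodAssoc
  have sw : MeasurePreserving (Prod.swap : E × F → F × E) volume volume :=
    Measure.measurePreserving_swap
  have idE : MeasurePreserving (id : E → E) volume volume := MeasurePreserving.id _
  have idF : MeasurePreserving (id : F → F) volume volume := MeasurePreserving.id _
  have t2 := (sw.prod idF).comp s2.symm
  have t3 := s3.comp t2
  have t4 := s4.symm.comp ((idE.prod t3).comp s1)
  exact t4

lemma norm_pair_gt {E F : Type} [NormedAddCommGroup E] [NormedAddCommGroup F] {M : ℝ}
    {x : E} {y : F} (h : M < ‖x‖ ∨ M < ‖y‖) : M < ‖(x, y)‖ := by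
  rw [Prod.norm_def, lt_max_iff]; exact h

lemma marg_out {E F : Type} [NormedAddCommGroup E] [NormedAddCommGroup F] {M : ℝ}
    {f : E × F → ℝ} (hf0 : ∀ x, M < ‖x‖ → f x = 0) {x : E} (hx : M < ‖x‖) :
    ∀ y, f (x, y) = 0 := fun y => hf0 _ (norm_pair_gt (Or.inl hx))

section tensor

variable {E F : Type} [NormedAddCommGroup E] [MeasureSpace E] [BorelSpace E]
  [ProperSpace E] [IsFiniteMeasureOnCompacts (volume : Measure E)] [SigmaFinite (volume : Measure E)]
  [NormedAddCommGroup F] [MeasureSpace F] [BorelSpace F]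
  [ProperSpace F] [IsFiniteMeasureOnCompacts (volume : Measure F)] [SigmaFinite (volume : Measure F)]
  [(volume : Measure F).IsOpenPosMeasure]

lemma marg_bound {M C : ℝ} {k : F → ℝ} (hk : Measurable k) (hkb : ∀ x, 0 ≤ k x ∧ k x ≤ C)
    (hk0 : ∀ x, M < ‖x‖ → k x = 0) :
    0 ≤ ∫ x, k x ∧ ∫ x, k x ≤ C * volume.real (Metric.closedBall (0 : F) M) := by
  refine ⟨integral_nonneg fun x => (hkb x).1, ?_⟩
  have hi : Integrable k := int_bdd hk (B := C)
    (fun x => by rw [Real.norm_of_nonneg (hkb x).1]; exact (hkb x).2) hk0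
  rw [← setIntegral_eq_integral_of_forall_compl_eq_zero (s := Metric.closedBall (0 : F) M)
    (fun x hx => hk0 x (by rw [mem_closedBall_zero_iff] at hx; exact not_le.mp hx))]
  have hv : volume (Metric.closedBall (0 : F) M) ≠ ∞ :=
    (isCompact_closedBall 0 M).measure_lt_top.ne
  calc ∫ x in Metric.closedBall (0 : F) M, k x ≤ ∫ x in Metric.closedBall (0 : F) M, C :=
        setIntegral_mono hi.integrableOn (integrableOn_const hv) (fun x => (hkb x).2)
    _ = _ := by simp [mul_comm]

lemma marg_low {M c C : ℝ} {k : F → ℝ} (hk : Measurable k) (hc : 0 < c)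
    (hkb : ∀ x, ‖x‖ ≤ M → c ≤ k x ∧ k x ≤ C)
    (hk0 : ∀ x, M < ‖x‖ → k x = 0) :
    c * volume.real (Metric.closedBall (0 : F) M) ≤ ∫ x, k x := by
  have hi : Integrable k := int_bdd hk (B := |C|)
    (fun x => by
      rcases le_or_gt ‖x‖ M with h | h
      · rw [Real.norm_of_nonneg (hc.le.trans (hkb x h).1)]
        exact (hkb x h).2.trans (le_abs_self _)
      · rw [hk0 x h]; simp) hk0
  rw [← setIntegral_eq_integral_of_forall_compl_eq_zero (s := Metric.closedBall (0 : F) M)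
    (fun x hx => hk0 x (by rw [mem_closedBall_zero_iff] at hx; exact not_le.mp hx))]
  have hv : volume (Metric.closedBall (0 : F) M) ≠ ∞ :=
    (isCompact_closedBall 0 M).measure_lt_top.ne
  calc c * volume.real (Metric.closedBall (0 : F) M) = ∫ x in Metric.closedBall (0 : F) M, c := by
        simp [mul_comm]
    _ ≤ _ := setIntegral_mono_on (integrableOn_const hv) hi.integrableOn
        Metric.isClosed_closedBall.measurableSet
        (fun x hx => (hkb x (mem_closedBall_zero_iff.mp hx)).1)

lemma lieb_prod {a b D1 D2 : ℝ} (hE : LiebEPI a b E D1) (hF : LiebEPI a b F D2) :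
    LiebEPI a b (E × F) (D1 + D2) := by
  intro M C c f g r hM hc hf hg hr hfb hf0 hgb hg0 hrb hr0
  have hC : 0 < C := by
    have := hrb 0 (by simp [hM.le]); linarith
  set κ := a ^ 2 * Real.log a + b ^ 2 * Real.log b with hκ
  set mg : (E × F → ℝ) → E → ℝ := fun k x => ∫ y, k (x, y) with hmg
  have mgm : ∀ {k : E × F → ℝ}, Measurable k → Measurable (mg k) := fun hk =>
    (hk.stronglyMeasurable.integral_prod_right' (ν := (volume : Measure F))).measurable
  set V := volume.real (Metric.closedBall (0 : F) M) with hV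
  set V2 := volume.real (Metric.closedBall (0 : F) (2 * M)) with hV2
  have hV2p : 0 < V2 := by
    rw [hV2, measureReal_def]
    apply ENNReal.toReal_pos
    · exact (Metric.measure_closedBall_pos volume 0 (by linarith)).ne'
    · exact (isCompact_closedBall 0 _).measure_lt_top.ne
  have hVnn : 0 ≤ V := measureReal_nonneg
  set K := C * V + C * V2 with hK
  have hrC : ∀ x, 0 ≤ r x ∧ r x ≤ C := fun x => by
    rcases le_or_gt ‖x‖ (2 * M) with h | h
    · exact ⟨hc.le.trans (hrb x h).1, (hrb x h).2⟩
    · rw [hr0 x h]; exact ⟨le_rfl, hC.le⟩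
  have mgb : ∀ {k : E × F → ℝ}, Measurable k → (∀ x, 0 ≤ k x ∧ k x ≤ C) →
      (∀ x, M < ‖x‖ → k x = 0) → ∀ x, 0 ≤ mg k x ∧ mg k x ≤ K := by
    intro k hk hkb hk0 x
    have := marg_bound (F := F) (k := fun y => k (x, y)) (M := M) (C := C)
      (hk.comp measurable_prodMk_left) (fun y => hkb _)
      (fun y hy => hk0 _ (norm_pair_gt (Or.inr hy)))
    refine ⟨this.1, this.2.trans ?_⟩
    rw [hK]; nlinarith
  have mg0 : ∀ {k : E × F → ℝ} {M' : ℝ}, (∀ x, M' < ‖x‖ → k x = 0) →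
      ∀ x, M' < ‖x‖ → mg k x = 0 := by
    intro k M' hk0 x hx
    simp only [hmg]
    simp_rw [marg_out hk0 hx]; simp
  have rb : ∀ z, ‖z‖ ≤ 2 * M → c * V2 ≤ mg r z ∧ mg r z ≤ K := by
    intro z hz
    constructor
    · exact marg_low (F := F) (C := C) (k := fun y => r (z, y)) (hr.comp measurable_prodMk_left) hc
        (fun y hy => hrb _ (by rw [Prod.norm_def]; exact max_le hz hy))
        (fun y hy => hr0 _ (norm_pair_gt (Or.inr hy)))
    · have := marg_bound (F := F) (k := fun y => r (z, y)) (M := 2 * M) (C := C)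
        (hr.comp measurable_prodMk_left) (fun y => hrC _)
        (fun y hy => hr0 _ (norm_pair_gt (Or.inr hy)))
      refine this.2.trans ?_
      rw [hK]; nlinarith
  have outer := hE M K (c * V2) (mg f) (mg g) (mg r) hM (by positivity) (mgm hf) (mgm hg) (mgm hr)
    (mgb hf hfb hf0) (mg0 hf0) (mgb hg hgb hg0) (mg0 hg0) rb (mg0 hr0)
  have ii : ∀ {k : E × F → ℝ} {M' : ℝ}, Measurable k → (∀ x, 0 ≤ k x ∧ k x ≤ C) →
      (∀ x, M' < ‖x‖ → k x = 0) → Integrable k := by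
    intro k M' h1 h2 h3
    exact int_bdd h1 (B := C) (fun x => by rw [Real.norm_of_nonneg (h2 x).1]; exact (h2 x).2) h3
  have ii' : ∀ {k : E × F → ℝ}, Measurable k → (∀ x, 0 ≤ k x ∧ k x ≤ C) →
      (∀ x, M < ‖x‖ → k x = 0) → Integrable (fun p => k p * Real.log (k p)) := by
    intro k h1 h2 h3
    obtain ⟨B, hB⟩ := bdd_mul_log C
    exact int_bdd (by fun_prop) (fun x => hB _ (h2 x)) (fun x hx => by rw [h3 x hx]; simp)
  have ii1 : ∀ {k : E → ℝ}, Measurable k → (∀ x, 0 ≤ k x ∧ k x ≤ K) →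
      (∀ x, M < ‖x‖ → k x = 0) → Integrable k := by
    intro k h1 h2 h3
    exact int_bdd h1 (B := K) (fun x => by rw [Real.norm_of_nonneg (h2 x).1]; exact (h2 x).2) h3
  have ii1' : ∀ {k : E → ℝ}, Measurable k → (∀ x, 0 ≤ k x ∧ k x ≤ K) →
      (∀ x, M < ‖x‖ → k x = 0) → Integrable (fun p => k p * Real.log (k p)) := by
    intro k h1 h2 h3
    obtain ⟨B, hB⟩ := bdd_mul_log K
    exact int_bdd (by fun_prop) (fun x => hB _ (h2 x)) (fun x hx => by rw [h3 x hx]; simp)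
  have fub : ∀ {k : E × F → ℝ}, Integrable k → ∫ x, mg k x = ∫ p, k p := by
    intro k hk
    exact (integral_prod k hk).symm
  set φf : E → ℝ := mg (fun p => f p * Real.log (f p)) with hφf
  set φg : E → ℝ := mg (fun p => g p * Real.log (g p)) with hφg
  have iφf : Integrable φf := (ii' hf hfb hf0).integral_prod_left
  have iφg : Integrable φg := (ii' hg hgb hg0).integral_prod_left
  have i1 := ii1 (mgm hf) (mgb hf hfb hf0) (mg0 hf0)
  have j1 := ii1 (mgm hg) (mgb hg hgb hg0) (mg0 hg0)
  have i2 := ii1' (mgm hf) (mgb hf hfb hf0) (mg0 hf0)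
  have j2 := ii1' (mgm hg) (mgb hg hgb hg0) (mg0 hg0)
  set k : (E × F) × (E × F) → ℝ := fun p => f p.1 * g p.2 * Real.log (r (p.1 + p.2)) with hk
  have hkm : Measurable k := by fun_prop
  have hsupp : ∀ {X : Type} [NormedAddCommGroup X] {u v w : X → ℝ} {c' C1 : ℝ} (p : X × X),
      (∀ x, M < ‖x‖ → u x = 0) → (∀ x, M < ‖x‖ → v x = 0) → (∀ x, 0 ≤ u x ∧ u x ≤ C1) →
      (∀ x, 0 ≤ v x ∧ v x ≤ C1) → 0 < c' → (∀ x, ‖x‖ ≤ 2 * M → c' ≤ w x ∧ w x ≤ C1) →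
      ‖u p.1 * v p.2 * Real.log (w (p.1 + p.2))‖ ≤ C1 * C1 * (|Real.log c'| + |Real.log C1|) := by
    intro X _ u v w c' C1 p hu0 hv0 hub hvb hc' hwb
    have hC1 : 0 ≤ C1 := (hub 0).1.trans (hub 0).2
    rcases le_or_gt ‖p.1‖ M with h | h
    · rcases le_or_gt ‖p.2‖ M with h' | h'
      · rw [norm_mul, norm_mul, Real.norm_of_nonneg (hub _).1, Real.norm_of_nonneg (hvb _).1]
        gcongr
        · exact (hvb _).1
        · exact (hub _).2
        · exact (hvb _).2
        · exact bdd_log hc' (hwb _ ((norm_add_le _ _).trans (by linarith)))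
      · rw [hv0 _ h']; simp; positivity
    · rw [hu0 _ h]; simp; positivity
  have hsupp0 : ∀ {X : Type} [NormedAddCommGroup X] {u v w : X → ℝ} (p : X × X),
      (∀ x, M < ‖x‖ → u x = 0) → (∀ x, M < ‖x‖ → v x = 0) → M < ‖p‖ →
      u p.1 * v p.2 * Real.log (w (p.1 + p.2)) = 0 := by
    intro X _ u v w p hu0 hv0 hp
    rw [Prod.norm_def, lt_max_iff] at hp
    rcases hp with h | h
    · rw [hu0 _ h]; simp
    · rw [hv0 _ h]; simp
  have hki : Integrable k := int_bdd hkm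
    (fun p => hsupp p hf0 hg0 hfb hgb hc hrb) (fun p hp => hsupp0 p hf0 hg0 hp)
  set sh : (E × E) × (F × F) → (E × F) × (E × F) :=
    fun q => ((q.1.1, q.2.1), (q.1.2, q.2.2)) with hsh
  have hmp : MeasurePreserving sh volume volume := mp_shuffle
  have hki' : Integrable (fun q => k (sh q)) := hmp.integrable_comp_of_integrable hki
  set I : E × E → ℝ := fun z => ∫ w : F × F, k (sh (z, w)) with hI
  have hIi : Integrable I := Integrable.integral_prod_left (f := fun q => k (sh q)) hki'
  have hIk : ∫ p, k p = ∫ z, I z := by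
    have h1 := integral_map (μ := volume) hmp.measurable.aemeasurable (f := k)
      hkm.aestronglyMeasurable
    rw [hmp.map_eq] at h1
    rw [h1]
    exact integral_prod _ hki'
  have inner : ∀ z : E × E, I z ≤ mg f z.1 * mg g z.2 * Real.log (mg r (z.1 + z.2))
      + a ^ 2 * (φf z.1 * mg g z.2 - (mg f z.1 * Real.log (mg f z.1)) * mg g z.2)
      + b ^ 2 * (mg f z.1 * φg z.2 - mg f z.1 * (mg g z.2 * Real.log (mg g z.2)))
      + mg f z.1 * mg g z.2 * (D2 * κ) := by
    intro z
    rcases le_or_gt ‖z.1‖ M with h | h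
    · rcases le_or_gt ‖z.2‖ M with h' | h'
      · have := hF M C c (fun y => f (z.1, y)) (fun y => g (z.2, y)) (fun y => r (z.1 + z.2, y))
          hM hc (hf.comp measurable_prodMk_left) (hg.comp measurable_prodMk_left)
          (hr.comp measurable_prodMk_left) (fun y => hfb _)
          (fun y hy => hf0 _ (norm_pair_gt (Or.inr hy))) (fun y => hgb _)
          (fun y hy => hg0 _ (norm_pair_gt (Or.inr hy)))
          (fun y hy => hrb _ (by
            rw [Prod.norm_def]
            exact max_le ((norm_add_le _ _).trans (by linarith)) hy))
          (fun y hy => hr0 _ (norm_pair_gt (Or.inr hy)))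
        refine this.trans (le_of_eq ?_)
        simp only [hφf, hφg, hmg]
        ring
      · have e1 : mg g z.2 = 0 := mg0 hg0 _ h'
        have e2 : φg z.2 = 0 := mg0 (k := fun p => g p * Real.log (g p)) (fun x hx => by simp [hg0 x hx]) _ h'
        have e3 : I z = 0 := by
          simp only [hI, hk, hsh]
          simp_rw [marg_out hg0 h']; simp
        rw [e1, e2, e3]; simp
    · have e1 : mg f z.1 = 0 := mg0 hf0 _ h
      have e2 : φf z.1 = 0 := mg0 (k := fun p => f p * Real.log (f p)) (fun x hx => by simp [hf0 x hx]) _ h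
      have e3 : I z = 0 := by
        simp only [hI, hk, hsh]
        simp_rw [marg_out hf0 h]; simp
      rw [e1, e2, e3]; simp
  have t1 : Integrable (fun z : E × E => mg f z.1 * mg g z.2 * Real.log (mg r (z.1 + z.2))) := by
    have m1 := mgm hf
    have m2 := mgm hg
    have m3 := mgm hr
    refine int_bdd (by fun_prop)
      (fun p => hsupp p (mg0 hf0) (mg0 hg0) (mgb hf hfb hf0) (mgb hg hgb hg0)
        (by positivity : 0 < c * V2) rb) (fun p hp => hsupp0 p (mg0 hf0) (mg0 hg0) hp)
  have t2 : Integrable (fun z : E × E => φf z.1 * mg g z.2) := iφf.mul_prod j1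
  have t3 : Integrable (fun z : E × E => (mg f z.1 * Real.log (mg f z.1)) * mg g z.2) :=
    i2.mul_prod j1
  have t4 : Integrable (fun z : E × E => mg f z.1 * φg z.2) := i1.mul_prod iφg
  have t5 : Integrable (fun z : E × E => mg f z.1 * (mg g z.2 * Real.log (mg g z.2))) :=
    i1.mul_prod j2
  have t6 : Integrable (fun z : E × E => mg f z.1 * mg g z.2) := i1.mul_prod j1
  have u2 := (t2.sub t3).const_mul (a ^ 2)
  have u3 := (t4.sub t5).const_mul (b ^ 2)
  have u4 := t6.mul_const (D2 * κ)
  have hineq := integral_mono hIi (((t1.add u2).add u3).add u4) inner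
  have e1 := integral_add ((t1.add u2).add u3) u4
  have e2 := integral_add (t1.add u2) u3
  have e3 := integral_add t1 u2
  have e4 := integral_sub t2 t3
  have e5 := integral_sub t4 t5
  have p2 : ∫ z : E × E, φf z.1 * mg g z.2 = (∫ x, φf x) * ∫ x, mg g x := integral_prod_mul _ _
  have p3 : ∫ z : E × E, (mg f z.1 * Real.log (mg f z.1)) * mg g z.2
      = (∫ x, mg f x * Real.log (mg f x)) * ∫ x, mg g x :=
    integral_prod_mul (fun x => mg f x * Real.log (mg f x)) _
  have p4 : ∫ z : E × E, mg f z.1 * φg z.2 = (∫ x, mg f x) * ∫ x, φg x := integral_prod_mul _ _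
  have p5 : ∫ z : E × E, mg f z.1 * (mg g z.2 * Real.log (mg g z.2))
      = (∫ x, mg f x) * ∫ x, mg g x * Real.log (mg g x) :=
    integral_prod_mul _ (fun x => mg g x * Real.log (mg g x))
  have p6 : ∫ z : E × E, mg f z.1 * mg g z.2 = (∫ x, mg f x) * ∫ x, mg g x := integral_prod_mul _ _
  simp only [Pi.add_apply, Pi.sub_apply, integral_const_mul, integral_mul_const]
    at hineq e1 e2 e3 e4 e5
  rw [e1, e2, e3, e4, e5, p2, p3, p4, p5, p6] at hineq
  have q1 : ∫ x, mg f x = ∫ p, f p := fub (ii hf hfb hf0)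
  have q2 : ∫ x, mg g x = ∫ p, g p := fub (ii hg hgb hg0)
  have q3 : ∫ x, mg r x = ∫ p, r p := fub (ii hr hrC hr0)
  have q4 : ∫ x, φf x = ∫ p, f p * Real.log (f p) := fub (ii' hf hfb hf0)
  have q5 : ∫ x, φg x = ∫ p, g p * Real.log (g p) := fub (ii' hg hgb hg0)
  rw [q1, q2, q4, q5] at hineq
  rw [q1, q2, q3] at outer
  rw [hIk]
  refine (hineq.trans ?_)
  linarith [outer]

end tensor

/-! ### Part 5: dimension `d` -/

lemma mp_integral {α β : Type*} [MeasurableSpace α] [MeasurableSpace β] {μ : Measure α}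
    {ν : Measure β} {T : α → β} (hT : MeasurePreserving T μ ν) {k : β → ℝ} (hk : Measurable k) :
    ∫ x, k (T x) ∂μ = ∫ y, k y ∂ν := by
  rw [← hT.map_eq, integral_map hT.measurable.aemeasurable hk.aestronglyMeasurable]

lemma lieb_transfer {E F : Type} [NormedAddCommGroup E] [MeasureSpace E]
    [NormedAddCommGroup F] [MeasureSpace F] [MeasurableAdd₂ F]
    [SigmaFinite (volume : Measure E)] [SigmaFinite (volume : Measure F)]
    {a b D : ℝ} (hE : LiebEPI a b E D) (T : E → F) (hT : MeasurePreserving T volume volume)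
    (hadd : ∀ x y, T (x + y) = T x + T y) (hn : ∀ x, ‖T x‖ = ‖x‖) : LiebEPI a b F D := by
  intro M C c f g r hM hc hf hg hr hfb hf0 hgb hg0 hrb hr0
  have key := hE M C c (fun x => f (T x)) (fun x => g (T x)) (fun x => r (T x)) hM hc
    (hf.comp hT.measurable) (hg.comp hT.measurable) (hr.comp hT.measurable)
    (fun x => hfb _) (fun x hx => hf0 _ (by rwa [hn])) (fun x => hgb _)
    (fun x hx => hg0 _ (by rwa [hn])) (fun x hx => hrb _ (by rwa [hn]))
    (fun x hx => hr0 _ (by rwa [hn]))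
  have e1 := mp_integral hT hf
  have e2 := mp_integral hT hg
  have e3 := mp_integral hT hr
  have e4 := mp_integral hT (k := fun x => f x * Real.log (f x)) (by fun_prop)
  have e5 := mp_integral hT (k := fun x => g x * Real.log (g x)) (by fun_prop)
  have e6 := mp_integral (hT.prod hT)
    (k := fun p : F × F => f p.1 * g p.2 * Real.log (r (p.1 + p.2))) (by fun_prop)
  simp only [Prod.map_apply, Prod.map_fst, Prod.map_snd] at e4 e5 e6
  simp only [hadd] at key
  rw [e1, e2, e3, e4, e5] at key
  exact (le_of_eq e6.symm).trans key

lemma lieb_zero {a b : ℝ} : LiebEPI a b (Fin 0 → ℝ) 0 := by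
  intro M C c f g r hM hc hf hg hr hfb hf0 hgb hg0 hrb hr0
  have hv : (volume : Measure (Fin 0 → ℝ)) = Measure.dirac 0 := by
    rw [volume_pi]
    exact Measure.pi_of_empty _ _
  have h1 : ∀ k : (Fin 0 → ℝ) → ℝ, ∫ x, k x = k 0 := by
    intro k
    rw [hv, integral_dirac]
  have h2 : ∀ k : (Fin 0 → ℝ) × (Fin 0 → ℝ) → ℝ, ∫ x, k x = k (0, 0) := by
    intro k
    rw [Measure.volume_eq_prod, hv, Measure.dirac_prod_dirac, integral_dirac]
  rw [h2]
  simp only [h1]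
  rw [add_zero]
  apply le_of_eq
  ring

lemma lieb_dim {a b : ℝ} (ha : 0 < a) (hb : 0 < b) (hab : a ^ 2 + b ^ 2 = 1) (d : ℕ) :
    LiebEPI a b (Fin d → ℝ) d := by
  induction d with
  | zero => simpa using lieb_zero
  | succ n ih =>
    have h := lieb_prod (lieb_1d ha hb hab) ih
    have hT := (volume_preserving_piFinSuccAbove (fun _ : Fin (n + 1) => ℝ) 0).symm
    have := lieb_transfer h _ hT ?_ ?_
    · have e : ((n + 1 : ℕ) : ℝ) = 1 + n := by push_cast; ring
      rw [e]; exact this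
    · intro x y
      funext i
      refine Fin.cases ?_ (fun j => ?_) i
      · simp [MeasurableEquiv.piFinSuccAbove]
      · simp [MeasurableEquiv.piFinSuccAbove]
    · intro x
      apply le_antisymm
      · rw [pi_norm_le_iff_of_nonneg (norm_nonneg _)]
        intro i
        refine Fin.cases ?_ (fun j => ?_) i
        · simpa [MeasurableEquiv.piFinSuccAbove] using norm_fst_le x
        · simpa [MeasurableEquiv.piFinSuccAbove] using (norm_le_pi_norm x.2 j).trans (norm_snd_le x)
      · rw [Prod.norm_def]
        apply max_le
        · have := norm_le_pi_norm
            ((MeasurableEquiv.piFinSuccAbove (fun _ : Fin (n + 1) => ℝ) 0).symm x) 0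
          simpa [MeasurableEquiv.piFinSuccAbove] using this
        · rw [pi_norm_le_iff_of_nonneg (norm_nonneg _)]
          intro j
          have := norm_le_pi_norm
            ((MeasurableEquiv.piFinSuccAbove (fun _ : Fin (n + 1) => ℝ) 0).symm x) j.succ
          simpa [MeasurableEquiv.piFinSuccAbove] using this

/-! ### Part 6: removing the truncation and conclusion -/

lemma log_clamp {t e K : ℝ} (ht : 0 < t) (he : 0 < e) (he1 : e ≤ 1) (hK : 1 ≤ K) :
    |Real.log (max e (min t K))| ≤ |Real.log t| := by
  rcases le_total t 1 with h | h
  · rw [min_eq_left (h.trans hK)]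
    have h1 : max e t ≤ 1 := max_le he1 h
    have h2 : 0 < max e t := lt_max_of_lt_left he
    rw [abs_of_nonpos (Real.log_nonpos h2.le h1), abs_of_nonpos (Real.log_nonpos ht.le h)]
    have := Real.log_le_log ht (le_max_right e t)
    linarith
  · have h0 : 1 ≤ min t K := le_min h hK
    rw [max_eq_right (he1.trans h0), abs_of_nonneg (Real.log_nonneg h0),
      abs_of_nonneg (Real.log_nonneg h)]
    exact Real.log_le_log (by linarith) (min_le_left _ _)

section final

variable {d : ℕ}

/-- truncation of a density -/
def trunc (f : (Fin d → ℝ) → ℝ) (n : ℕ) : (Fin d → ℝ) → ℝ :=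
  {x | f x ≤ (n : ℝ) + 1 ∧ ‖x‖ ≤ (n : ℝ) + 1}.indicator f

lemma trunc_set_meas {f : (Fin d → ℝ) → ℝ} (hf : Measurable f) (n : ℕ) :
    MeasurableSet {x | f x ≤ (n : ℝ) + 1 ∧ ‖x‖ ≤ (n : ℝ) + 1} :=
  (measurableSet_le hf measurable_const).inter (measurableSet_le measurable_norm measurable_const)

lemma trunc_meas {f : (Fin d → ℝ) → ℝ} (hf : Measurable f) (n : ℕ) : Measurable (trunc f n) :=
  hf.indicator (trunc_set_meas hf n)

lemma trunc_bdd {f : (Fin d → ℝ) → ℝ} (hf0 : ∀ x, 0 ≤ f x) (n : ℕ) (x : Fin d → ℝ) :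
    0 ≤ trunc f n x ∧ trunc f n x ≤ (n : ℝ) + 1 := by
  unfold trunc
  by_cases h : x ∈ {x | f x ≤ (n : ℝ) + 1 ∧ ‖x‖ ≤ (n : ℝ) + 1}
  · rw [Set.indicator_of_mem h]; exact ⟨hf0 x, h.1⟩
  · rw [Set.indicator_of_notMem h]; exact ⟨le_rfl, by positivity⟩

lemma trunc_out {f : (Fin d → ℝ) → ℝ} (n : ℕ) (x : Fin d → ℝ) (hx : (n : ℝ) + 1 < ‖x‖) :
    trunc f n x = 0 := by
  unfold trunc
  rw [Set.indicator_of_notMem]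
  exact fun h => absurd h.2 (not_le.mpr hx)

lemma ev_ge (t : ℝ) : ∀ᶠ n : ℕ in Filter.atTop, t ≤ (n : ℝ) + 1 := by
  filter_upwards [tendsto_natCast_atTop_atTop.eventually_ge_atTop t] with n hn
  linarith

lemma trunc_ev (f : (Fin d → ℝ) → ℝ) (x : Fin d → ℝ) :
    ∀ᶠ n : ℕ in Filter.atTop, x ∈ {x | f x ≤ (n : ℝ) + 1 ∧ ‖x‖ ≤ (n : ℝ) + 1} := by
  filter_upwards [ev_ge (f x), ev_ge ‖x‖] with n h1 h2
  exact ⟨h1, h2⟩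

lemma trunc_lim1 {f : (Fin d → ℝ) → ℝ} (hf : Measurable f) (hi : Integrable f) :
    Filter.Tendsto (fun n => ∫ x, trunc f n x) Filter.atTop (nhds (∫ x, f x)) := by
  apply tendsto_integral_of_dominated_convergence (fun x => ‖f x‖)
    (fun n => (trunc_meas hf n).aestronglyMeasurable) hi.norm
  · intro n
    exact Filter.Eventually.of_forall fun x => norm_indicator_le_norm_self _ _
  · refine Filter.Eventually.of_forall fun x => ?_
    apply tendsto_const_nhds.congr'
    filter_upwards [trunc_ev f x] with n hn
    unfold trunc
    rw [Set.indicator_of_mem (show x ∈ {x | f x ≤ (n : ℝ) + 1 ∧ ‖x‖ ≤ (n : ℝ) + 1} from hn)]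

lemma trunc_lim2 {f : (Fin d → ℝ) → ℝ} (hf : Measurable f)
    (hi : Integrable (fun x => f x * Real.log (f x))) :
    Filter.Tendsto (fun n => ∫ x, trunc f n x * Real.log (trunc f n x)) Filter.atTop
      (nhds (∫ x, f x * Real.log (f x))) := by
  apply tendsto_integral_of_dominated_convergence (fun x => ‖f x * Real.log (f x)‖)
    (fun n => by
      have := trunc_meas hf n
      exact Measurable.aestronglyMeasurable (by fun_prop)) hi.norm
  · intro n
    refine Filter.Eventually.of_forall fun x => ?_
    unfold trunc
    by_cases h : x ∈ {x | f x ≤ (n : ℝ) + 1 ∧ ‖x‖ ≤ (n : ℝ) + 1}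
    · rw [Set.indicator_of_mem h]
    · rw [Set.indicator_of_notMem h, zero_mul, norm_zero]; exact norm_nonneg _
  · refine Filter.Eventually.of_forall fun x => ?_
    apply tendsto_const_nhds.congr'
    filter_upwards [trunc_ev f x] with n hn
    unfold trunc
    rw [Set.indicator_of_mem (show x ∈ {x | f x ≤ (n : ℝ) + 1 ∧ ‖x‖ ≤ (n : ℝ) + 1} from hn)]

lemma epi_lin {a b : ℝ} (ha : 0 < a) (hb : 0 < b) (hab : a ^ 2 + b ^ 2 = 1)
    {f g h : (Fin d → ℝ) → ℝ} (hf : Measurable f) (hg : Measurable g) (hh : Measurable h)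
    (hf0 : ∀ x, 0 ≤ f x) (hg0 : ∀ x, 0 ≤ g x) (hh0 : ∀ x, 0 ≤ h x)
    (fi : Integrable f) (gi : Integrable g) (hi : Integrable h)
    (f1 : ∫ x, f x = 1) (g1 : ∫ x, g x = 1) (h1 : ∫ x, h x = 1)
    (hfInt : Integrable (fun x => f x * Real.log (f x)) volume)
    (hgInt : Integrable (fun x => g x * Real.log (g x)) volume)
    (hhInt : Integrable (fun x => h x * Real.log (h x)) volume)
    (hlaw : Measure.map (fun p : (Fin d → ℝ) × (Fin d → ℝ) => p.1 + p.2)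
      ((volume.withDensity (fun x => ENNReal.ofReal (f x))).prod
        (volume.withDensity (fun x => ENNReal.ofReal (g x))))
      = volume.withDensity (fun x => ENNReal.ofReal (h x))) :
    ∫ x, h x * Real.log (h x) ≤ a ^ 2 * (∫ x, f x * Real.log (f x))
      + b ^ 2 * (∫ x, g x * Real.log (g x))
      + d * (a ^ 2 * Real.log a + b ^ 2 * Real.log b) := by
  set κ := a ^ 2 * Real.log a + b ^ 2 * Real.log b with hκ
  set μh : Measure (Fin d → ℝ) := volume.withDensity (fun x => ENNReal.ofReal (h x)) with hμh
  set J : Measure ((Fin d → ℝ) × (Fin d → ℝ)) := volume.withDensity (fun p => ENNReal.ofReal (f p.1 * g p.2)) with hJ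
  have hJp : (volume.withDensity (fun x => ENNReal.ofReal (f x))).prod
        (volume.withDensity (fun x => ENNReal.ofReal (g x))) = J := by
    rw [prod_withDensity hf.ennreal_ofReal hg.ennreal_ofReal, hJ, Measure.volume_eq_prod]
    congr 1; funext p
    rw [ENNReal.ofReal_mul (hf0 _)]
  rw [hJp] at hlaw
  have addm : Measurable (fun p : (Fin d → ℝ) × (Fin d → ℝ) => p.1 + p.2) := by fun_prop
  set V : ℕ → ℝ := fun n => volume.real (Metric.closedBall (0 : (Fin d → ℝ)) (2 * ((n : ℝ) + 1))) with hV
  have hV0 : ∀ n, 0 ≤ V n := fun n => measureReal_nonneg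
  set ε : ℕ → ℝ := fun n => 1 / (((n : ℝ) + 1) * (V n + 1)) with hε
  have hε0 : ∀ n, 0 < ε n := fun n => by have := hV0 n; simp only [hε]; positivity
  have hεn : ∀ n, ε n ≤ 1 / ((n : ℝ) + 1) := fun n => by
    have := hV0 n
    simp only [hε]
    apply one_div_le_one_div_of_le (by positivity)
    nlinarith [(Nat.cast_nonneg n : (0 : ℝ) ≤ n)]
  have hεV : ∀ n, ε n * V n ≤ 1 / ((n : ℝ) + 1) := fun n => by
    have := hV0 n
    simp only [hε]
    rw [div_mul_eq_mul_div, div_le_div_iff₀ (by positivity) (by positivity)]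
    nlinarith [(Nat.cast_nonneg n : (0 : ℝ) ≤ n)]
  have hN1 : ∀ n : ℕ, (1 : ℝ) ≤ (n : ℝ) + 1 := fun n => by
    linarith [(Nat.cast_nonneg n : (0 : ℝ) ≤ n)]
  have hε1 : ∀ n, ε n ≤ 1 := fun n => (hεn n).trans (by
    rw [div_le_one (by positivity)]; exact hN1 n)
  set cl : ℕ → (Fin d → ℝ) → ℝ := fun n z => max (ε n) (min (h z) ((n : ℝ) + 1)) with hcl
  have clm : ∀ n, Measurable (cl n) := fun n => by
    simp only [hcl]; fun_prop
  set B : ℕ → Set (Fin d → ℝ) := fun n => Metric.closedBall (0 : (Fin d → ℝ)) (2 * ((n : ℝ) + 1)) with hB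
  have Bm : ∀ n, MeasurableSet (B n) := fun n => Metric.isClosed_closedBall.measurableSet
  set r : ℕ → (Fin d → ℝ) → ℝ := fun n => (B n).indicator (cl n) with hr
  have rm : ∀ n, Measurable (r n) := fun n => (clm n).indicator (Bm n)
  have r_in : ∀ (n : ℕ) z, ‖z‖ ≤ 2 * ((n : ℝ) + 1) → r n z = cl n z := fun n z hz => by
    simp only [hr]; rw [Set.indicator_of_mem]; simpa [hB] using hz
  have r_out : ∀ (n : ℕ) z, 2 * ((n : ℝ) + 1) < ‖z‖ → r n z = 0 := fun n z hz => by
    simp only [hr]; rw [Set.indicator_of_notMem]; simpa [hB] using hz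
  have cl_b : ∀ n z, ε n ≤ cl n z ∧ cl n z ≤ (n : ℝ) + 1 := fun n z =>
    ⟨le_max_left _ _, max_le ((hε1 n).trans (hN1 n)) (min_le_right _ _)⟩
  have key : ∀ n : ℕ, _ := fun n => lieb_dim ha hb hab d ((n : ℝ) + 1) ((n : ℝ) + 1) (ε n)
    (trunc f n) (trunc g n) (r n) (by positivity) (hε0 n) (trunc_meas hf n) (trunc_meas hg n)
    (rm n) (trunc_bdd hf0 n) (trunc_out n) (trunc_bdd hg0 n) (trunc_out n)
    (fun z hz => by rw [r_in n z hz]; exact cl_b n z) (r_out n)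
  have rmass : ∀ n, Real.log (∫ x, r n x) ≤ Real.log (1 + 1 / ((n : ℝ) + 1)) := by
    intro n
    have r0 : ∀ x, 0 ≤ r n x := fun x =>
      Set.indicator_nonneg (fun y _ => (hε0 n).le.trans (cl_b n y).1) x
    have hBfin : volume (B n) ≠ ∞ := (isCompact_closedBall _ _).measure_lt_top.ne
    have ci : Integrable ((B n).indicator (fun _ => ε n)) :=
      (integrable_indicator_iff (Bm n)).mpr (integrableOn_const hBfin)
    have hle : ∫ x, r n x ≤ ∫ x, (h x + (B n).indicator (fun _ => ε n) x) := by
      apply integral_mono_of_nonneg (Filter.Eventually.of_forall r0) (hi.add ci)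
      refine Filter.Eventually.of_forall fun x => ?_
      simp only [hr, Pi.add_apply]
      by_cases hx : x ∈ B n
      · rw [Set.indicator_of_mem hx, Set.indicator_of_mem hx]
        simp only [hcl]
        apply max_le
        · linarith [hh0 x]
        · exact (min_le_left _ _).trans (by linarith [hε0 n])
      · rw [Set.indicator_of_notMem hx, Set.indicator_of_notMem hx]
        linarith [hh0 x]
    rw [integral_add hi ci, h1, integral_indicator_const _ (Bm n)] at hle
    have hle' : ∫ x, r n x ≤ 1 + 1 / ((n : ℝ) + 1) := by
      refine hle.trans ?_
      have := hεV n
      simp only [hV] at this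
      rw [smul_eq_mul, mul_comm]
      linarith
    have hp : (0 : ℝ) < 1 / ((n : ℝ) + 1) := by positivity
    rcases (integral_nonneg r0 : 0 ≤ ∫ x, r n x).eq_or_lt with h' | h'
    · rw [← h', Real.log_zero]
      exact Real.log_nonneg (by linarith)
    · exact Real.log_le_log h' hle'
  set A : ((Fin d → ℝ) → ℝ) → ℕ → Set (Fin d → ℝ) :=
    fun k n => {x | k x ≤ (n : ℝ) + 1 ∧ ‖x‖ ≤ (n : ℝ) + 1} with hA
  set Q : ℕ → (Fin d → ℝ) × (Fin d → ℝ) → ℝ := fun n => (A f n ×ˢ A g n).indicator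
    (fun p => Real.log (r n (p.1 + p.2))) with hQ
  have Qm : ∀ n, Measurable (Q n) := fun n => by
    have := rm n
    exact Measurable.indicator (by fun_prop) ((trunc_set_meas hf n).prod (trunc_set_meas hg n))
  have lhs : ∀ n, ∫ p : (Fin d → ℝ) × (Fin d → ℝ), trunc f n p.1 * trunc g n p.2 * Real.log (r n (p.1 + p.2))
      = ∫ p, Q n p ∂J := by
    intro n
    rw [hJ, integral_density (by fun_prop) (fun p => mul_nonneg (hf0 _) (hg0 _))]
    congr 1; funext p
    simp only [hQ, trunc]
    by_cases hp1 : p.1 ∈ A f n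
    · by_cases hp2 : p.2 ∈ A g n
      · rw [Set.indicator_of_mem hp1, Set.indicator_of_mem hp2,
          Set.indicator_of_mem (Set.mk_mem_prod hp1 hp2)]
      · rw [Set.indicator_of_notMem hp2, Set.indicator_of_notMem
          (show p ∉ A f n ×ˢ A g n from fun hx => hp2 hx.2)]; simp
    · rw [Set.indicator_of_notMem hp1, Set.indicator_of_notMem
        (show p ∉ A f n ×ˢ A g n from fun hx => hp1 hx.1)]; simp
  have hpos : ∀ᵐ z ∂μh, 0 < h z := by
    rw [hμh, ae_withDensity_iff hh.ennreal_ofReal]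
    refine Filter.Eventually.of_forall fun z hz => ?_
    rw [ne_eq, ENNReal.ofReal_eq_zero, not_le] at hz
    exact hz
  have hpos' : ∀ᵐ p ∂J, 0 < h (p.1 + p.2) := by
    rw [← hlaw] at hpos
    exact ae_of_ae_map addm.aemeasurable hpos
  have logi : Integrable (fun z => Real.log (h z)) μh := by
    rw [hμh, integrable_withDensity_iff_integrable_smul' hh.ennreal_ofReal (by simp)]
    refine hhInt.congr (Filter.Eventually.of_forall fun x => ?_)
    simp only [smul_eq_mul]
    rw [ENNReal.toReal_ofReal (hh0 x)]
  have logi' : Integrable (fun p : (Fin d → ℝ) × (Fin d → ℝ) => Real.log (h (p.1 + p.2))) J := by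
    rw [← hlaw] at logi
    exact logi.comp_measurable addm
  have Qlim : Filter.Tendsto (fun n => ∫ p, Q n p ∂J) Filter.atTop
      (nhds (∫ p, Real.log (h (p.1 + p.2)) ∂J)) := by
    apply tendsto_integral_of_dominated_convergence (fun p => ‖Real.log (h (p.1 + p.2))‖)
      (fun n => (Qm n).aestronglyMeasurable) logi'.norm
    · intro n
      filter_upwards [hpos'] with p hp
      simp only [hQ]
      by_cases hx : p ∈ A f n ×ˢ A g n
      · rw [Set.indicator_of_mem hx, r_in n _ ((norm_add_le _ _).trans (by
          linarith [hx.1.2, hx.2.2]))]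
        exact log_clamp hp (hε0 n) (hε1 n) (hN1 n)
      · rw [Set.indicator_of_notMem hx]; simp
    · filter_upwards [hpos'] with p hp
      apply tendsto_const_nhds.congr'
      filter_upwards [trunc_ev f p.1, trunc_ev g p.2, ev_ge (h (p.1 + p.2)),
        ev_ge (1 / h (p.1 + p.2))] with n n1 n2 n3 n4
      simp only [hQ]
      rw [Set.indicator_of_mem (show p ∈ A f n ×ˢ A g n from ⟨n1, n2⟩), r_in n _ ((norm_add_le _ _).trans (by
          linarith [n1.2, n2.2]))]
      simp only [hcl]
      rw [min_eq_left n3, max_eq_right]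
      refine (hεn n).trans ?_
      rw [div_le_iff₀ (by positivity)]
      rw [div_le_iff₀ hp] at n4
      linarith
  have Qval : ∫ p, Real.log (h (p.1 + p.2)) ∂J = ∫ x, h x * Real.log (h x) := by
    have hm : Measurable (fun z => Real.log (h z)) := by fun_prop
    rw [← integral_density hh hh0, ← hμh, ← hlaw,
      integral_map addm.aemeasurable hm.aestronglyMeasurable]
  rw [Qval] at Qlim
  have fl := trunc_lim1 hf fi
  have gl := trunc_lim1 hg gi
  rw [f1] at fl
  rw [g1] at gl
  have fll := trunc_lim2 hf hfInt
  have gll := trunc_lim2 hg hgInt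
  have mlc := Real.continuous_mul_log.tendsto 1
  simp only [Real.log_one, mul_zero] at mlc
  have fl' := mlc.comp fl
  have gl' := mlc.comp gl
  have rl : Filter.Tendsto (fun n : ℕ => Real.log (1 + 1 / ((n : ℝ) + 1))) Filter.atTop
      (nhds 0) := by
    have t := tendsto_one_div_add_atTop_nhds_zero_nat (𝕜 := ℝ)
    have t2 := (tendsto_const_nhds (x := (1 : ℝ))).add t
    have t3 := t2.log (by norm_num)
    simpa using t3
  have R := ((((fl.mul gl).mul rl).add (((gl.mul fll).sub (gl.mul fl')).const_mul (a ^ 2))).add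
    (((fl.mul gll).sub (fl.mul gl')).const_mul (b ^ 2))).add
      ((fl.mul gl).mul_const ((d : ℝ) * κ))
  have fin := le_of_tendsto_of_tendsto' Qlim R (fun n => by
    have k1 := key n
    rw [lhs n] at k1
    refine k1.trans ?_
    have m1 : 0 ≤ ∫ x, trunc f n x := integral_nonneg fun x => (trunc_bdd hf0 n x).1
    have m2 : 0 ≤ ∫ x, trunc g n x := integral_nonneg fun x => (trunc_bdd hg0 n x).1
    have := mul_le_mul_of_nonneg_left (rmass n) (mul_nonneg m1 m2)
    simp only [Function.comp]
    linarith)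
  linarith [fin]

end final

lemma density_mass {Ω : Type*} [MeasurableSpace Ω] {d : ℕ} {P : Measure Ω}
    [IsProbabilityMeasure P] {X : Ω → (Fin d → ℝ)} {f : (Fin d → ℝ) → ℝ}
    (hX : HasDensityFn P X f) : Integrable f ∧ ∫ x, f x = 1 := by
  obtain ⟨mX, mf, f0, hm⟩ := hX
  have hp : IsProbabilityMeasure (Measure.map X P) :=
    Measure.isProbabilityMeasure_map mX.aemeasurable
  have hu : ∫⁻ x, ENNReal.ofReal (f x) = 1 := by
    have := hp.measure_univ
    rw [hm, withDensity_apply _ MeasurableSet.univ, Measure.restrict_univ] at this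
    exact this
  have hi : Integrable f := by
    refine ⟨mf.aestronglyMeasurable, ?_⟩
    rw [hasFiniteIntegral_iff_ofReal (Filter.Eventually.of_forall f0), hu]
    simp
  refine ⟨hi, ?_⟩
  rw [integral_eq_lintegral_of_nonneg_ae (Filter.Eventually.of_forall f0)
    mf.aestronglyMeasurable, hu]
  simp

/-- Entropy Power Inequality: if `X` and `Y` are independent random vectors in `ℝ^d`
with densities whose Shannon entropies exist (the defining integrals are well defined
and finite), and `X + Y` also has a density with existing entropy, then
`N(X+Y) ≥ N(X) + N(Y)`. -/
theorem entropy_power_inequality {Ω : Type*} [MeasurableSpace Ω] {d : ℕ} (hd : 0 < d)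
    (P : Measure Ω) [IsProbabilityMeasure P]
    (X Y : Ω → (Fin d → ℝ)) (f g h : (Fin d → ℝ) → ℝ)
    (hX : HasDensityFn P X f) (hY : HasDensityFn P Y g)
    (hindep : IndepFun X Y P)
    (hsum : HasDensityFn P (fun ω => X ω + Y ω) h)
    (hfInt : Integrable (fun x => f x * Real.log (f x)) volume)
    (hgInt : Integrable (fun x => g x * Real.log (g x)) volume)
    (hhInt : Integrable (fun x => h x * Real.log (h x)) volume) :
    entropyPower d f + entropyPower d g ≤ entropyPower d h := by
  obtain ⟨fi, f1⟩ := density_mass hX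
  obtain ⟨gi, g1⟩ := density_mass hY
  obtain ⟨hi, h1⟩ := density_mass hsum
  obtain ⟨mX, mf, f0, lX⟩ := hX
  obtain ⟨mY, mg, g0, lY⟩ := hY
  obtain ⟨mS, mh, h0, lS⟩ := hsum
  have hlaw : Measure.map (fun p : (Fin d → ℝ) × (Fin d → ℝ) => p.1 + p.2)
      ((volume.withDensity (fun x => ENNReal.ofReal (f x))).prod
        (volume.withDensity (fun x => ENNReal.ofReal (g x))))
      = volume.withDensity (fun x => ENNReal.ofReal (h x)) := by
    rw [← lX, ← lY, ← lS,
      ← (indepFun_iff_map_prod_eq_prod_map_map mX.aemeasurable mY.aemeasurable).mp hindep,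
      Measure.map_map (by fun_prop) (mX.prodMk mY)]
    rfl
  have hd' : (0 : ℝ) < d := by exact_mod_cast hd
  set Nf := entropyPower d f with hNf
  set Ng := entropyPower d g with hNg
  have pf : 0 < Nf := Real.exp_pos _
  have pg : 0 < Ng := Real.exp_pos _
  set S := Nf + Ng with hS
  have pS : 0 < S := by positivity
  have lf : Real.log Nf = 2 * shannonEntropy d f / d := by rw [hNf, entropyPower, Real.log_exp]
  have lg : Real.log Ng = 2 * shannonEntropy d g / d := by rw [hNg, entropyPower, Real.log_exp]
  have a2 : √(Nf / S) ^ 2 = Nf / S := Real.sq_sqrt (by positivity)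
  have b2 : √(Ng / S) ^ 2 = Ng / S := Real.sq_sqrt (by positivity)
  have ab : Nf / S + Ng / S = 1 := by
    rw [← add_div]; exact div_self pS.ne'
  have key := epi_lin (a := √(Nf / S)) (b := √(Ng / S)) (Real.sqrt_pos.mpr (by positivity))
    (Real.sqrt_pos.mpr (by positivity)) (by rw [a2, b2, ab]) mf mg mh f0 g0 h0 fi gi hi f1 g1 h1
    hfInt hgInt hhInt hlaw
  rw [a2, b2, Real.log_sqrt (by positivity), Real.log_sqrt (by positivity),
    Real.log_div pf.ne' pS.ne', Real.log_div pg.ne' pS.ne', lf, lg] at key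
  have ef : ∫ x, f x * Real.log (f x) = -shannonEntropy d f := by simp [shannonEntropy]
  have eg : ∫ x, g x * Real.log (g x) = -shannonEntropy d g := by simp [shannonEntropy]
  have eh : ∫ x, h x * Real.log (h x) = -shannonEntropy d h := by simp [shannonEntropy]
  rw [ef, eg, eh] at key
  set u := Nf / S
  set v := Ng / S
  have hv : v = 1 - u := by linarith
  have e : u * -shannonEntropy d f + v * -shannonEntropy d g
      + d * (u * ((2 * shannonEntropy d f / d - Real.log S) / 2)
        + v * ((2 * shannonEntropy d g / d - Real.log S) / 2)) = -(d / 2 * Real.log S) := by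
    rw [hv]
    field_simp
    ring
  rw [e] at key
  have fin : Real.log S ≤ 2 * shannonEntropy d h / d := by
    rw [le_div_iff₀ hd']; linarith
  rw [entropyPower, ← Real.log_le_iff_le_exp pS]
  exact fin
end
end

section
/- Busemann-type theorem for convex measures: let κ ∈ [−∞, 1/2] and let (U,V) be a random vector in ℝ² whose distribution is symmetric (invariant under x ↦ −x) and κ-concave, with density. Then exp(h_∞(U+V)) ≤ exp(h_∞(U)) + exp(h_∞(V)); equivalently, 1/‖w‖_∞ ≤ 1/‖u‖_∞ + 1/‖v‖_∞, where w, u, v are the densities of U+V, U, V respectively. -/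
open MeasureTheory ProbabilityTheory Real
open scoped ENNReal Pointwise Classical

noncomputable section

/-- The real-valued random variable `X` has density `f` with respect to Lebesgue
measure on `ℝ`. -/
def HasDensityFn1 {Ω : Type*} [MeasurableSpace Ω]
    (P : Measure Ω) (X : Ω → ℝ) (f : ℝ → ℝ) : Prop :=
  Measurable X ∧ Measurable f ∧ (∀ x, 0 ≤ f x) ∧
    Measure.map X P = volume.withDensity (fun x => ENNReal.ofReal (f x))

/-- `h_∞(f) = -log ‖f‖_∞`, where `‖f‖_∞` is the essential supremum of the density. -/
def supEntropy1 (f : ℝ → ℝ) : ℝ :=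
  -Real.log ((eLpNorm f ⊤ volume).toReal)

/-- The generalized `κ`-mean `M_κ^t(a,b)` for `κ ∈ [-∞, ∞]`. -/
def genMean (κ : EReal) (t a b : ℝ) : ℝ :=
  if κ = ⊥ then min a b
  else if κ = ⊤ then max a b
  else if κ = 0 then a ^ (1 - t) * b ^ t
  else if κ.toReal < 0 ∧ (a = 0 ∨ b = 0) then 0
  else ((1 - t) * a ^ κ.toReal + t * b ^ κ.toReal) ^ (1 / κ.toReal)

/-- A measure `μ` on a real topological vector space is `κ`-concave in the sense of
Borell: its support has nonempty interior and
`μ((1-t)A + tB) ≥ M_κ^t(μ(A), μ(B))` for all Borel `A, B` and `t ∈ [0,1]`. -/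
def IsKappaConcave {E : Type*} [AddCommGroup E] [Module ℝ E] [TopologicalSpace E]
    [MeasurableSpace E] (κ : EReal) (μ : Measure E) : Prop :=
  (interior {x : E | ∀ U ∈ nhds x, 0 < μ U}).Nonempty ∧
    ∀ A B : Set E, MeasurableSet A → MeasurableSet B → ∀ t : ℝ, t ∈ Set.Icc (0:ℝ) 1 →
      genMean κ t (μ A).toReal (μ B).toReal ≤ (μ ((1 - t) • A + t • B)).toReal


section PartA
open Set

lemma bz_vol_add_le {X Y Z : Set ℝ} (hX : X.Nonempty) (hY : Y.Nonempty) (hZ : Z.OrdConnected)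
    (h : ∀ x ∈ X, ∀ y ∈ Y, x + y ∈ Z) : volume X + volume Y ≤ volume Z := by
  have key : ∀ x₁ ∈ X, ∀ x₂ ∈ X, ∀ y₁ ∈ Y, ∀ y₂ ∈ Y,
      edist x₁ x₂ + edist y₁ y₂ ≤ volume Z := by
    have key0 : ∀ x₁ ∈ X, ∀ x₂ ∈ X, ∀ y₁ ∈ Y, ∀ y₂ ∈ Y, x₁ ≤ x₂ → y₁ ≤ y₂ →
        edist x₁ x₂ + edist y₁ y₂ ≤ volume Z := by
      intro x₁ hx₁ x₂ hx₂ y₁ hy₁ y₂ hy₂ hx hy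
      have h1 : Icc (x₁ + y₁) (x₂ + y₂) ⊆ Z := hZ.out (h _ hx₁ _ hy₁) (h _ hx₂ _ hy₂)
      refine le_trans ?_ (measure_mono h1)
      rw [Real.volume_Icc, edist_dist, edist_dist, ← ENNReal.ofReal_add dist_nonneg dist_nonneg]
      apply ENNReal.ofReal_le_ofReal
      rw [Real.dist_eq, Real.dist_eq, abs_of_nonpos (by linarith), abs_of_nonpos (by linarith)]
      linarith
    intro x₁ hx₁ x₂ hx₂ y₁ hy₁ y₂ hy₂
    rcases le_total x₁ x₂ with hx | hx <;> rcases le_total y₁ y₂ with hy | hy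
    · exact key0 _ hx₁ _ hx₂ _ hy₁ _ hy₂ hx hy
    · rw [edist_comm y₁]; exact key0 _ hx₁ _ hx₂ _ hy₂ _ hy₁ hx hy
    · rw [edist_comm x₁]; exact key0 _ hx₂ _ hx₁ _ hy₁ _ hy₂ hx hy
    · rw [edist_comm x₁, edist_comm y₁]; exact key0 _ hx₂ _ hx₁ _ hy₂ _ hy₁ hx hy
  have h1 : ∀ y₁ ∈ Y, ∀ y₂ ∈ Y, Metric.ediam X + edist y₁ y₂ ≤ volume Z := by
    intro y₁ hy₁ y₂ hy₂
    have : Metric.ediam X ≤ volume Z - edist y₁ y₂ := by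
      apply Metric.ediam_le
      intro x₁ hx₁ x₂ hx₂
      exact ENNReal.le_sub_of_add_le_right (edist_ne_top _ _) (key _ hx₁ _ hx₂ _ hy₁ _ hy₂)
    have h3 : edist y₁ y₂ ≤ volume Z := by
      obtain ⟨x, hx⟩ := hX
      exact le_trans le_add_self (key x hx x hx _ hy₁ _ hy₂)
    calc _ ≤ volume Z - edist y₁ y₂ + edist y₁ y₂ := by gcongr
      _ = _ := tsub_add_cancel_of_le h3
  have h2 : Metric.ediam X + Metric.ediam Y ≤ volume Z := by
    by_cases hd : Metric.ediam X = ⊤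
    · obtain ⟨y, hy⟩ := hY
      have := h1 y hy y hy
      rw [hd, top_add, top_le_iff] at this
      rw [this]; exact le_top
    have : Metric.ediam Y ≤ volume Z - Metric.ediam X := by
      apply Metric.ediam_le
      intro y₁ hy₁ y₂ hy₂
      exact ENNReal.le_sub_of_add_le_left hd (h1 _ hy₁ _ hy₂)
    have h3 : Metric.ediam X ≤ volume Z := by
      obtain ⟨y, hy⟩ := hY
      exact le_trans le_self_add (h1 y hy y hy)
    calc _ ≤ Metric.ediam X + (volume Z - Metric.ediam X) := by gcongr
      _ = _ := add_tsub_cancel_of_le h3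
  exact le_trans (add_le_add (Real.volume_le_diam X) (Real.volume_le_diam Y)) h2

lemma bz_vol_half_le {L M : Set ℝ} (hM : M.OrdConnected)
    (h : ∀ a ∈ L, ∀ b ∈ L, (a - b) / 2 ∈ M) : volume L ≤ volume M := by
  refine le_trans (Real.volume_le_diam L) ?_
  apply Metric.ediam_le
  have key : ∀ a ∈ L, ∀ b ∈ L, a ≤ b → edist a b ≤ volume M := by
    intro a ha b hb hab
    have h1 : Icc ((a - b) / 2) ((b - a) / 2) ⊆ M := hM.out (h _ ha _ hb) (h _ hb _ ha)
    refine le_trans ?_ (measure_mono h1)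
    rw [Real.volume_Icc, edist_dist]
    apply ENNReal.ofReal_le_ofReal
    rw [Real.dist_eq, abs_of_nonpos (by linarith)]
    linarith
  intro a ha b hb
  rcases le_total a b with hab | hab
  · exact key _ ha _ hb hab
  · rw [edist_comm]; exact key _ hb _ ha hab

/-- One-dimensional Borell-Brascamp-Lieb type inequality. -/
lemma bz_bbl {A B C : ℝ → ℝ} (mA : Measurable A) (mB : Measurable B) (mC : Measurable C)
    (nA : ∀ x, 0 ≤ A x) (nB : ∀ x, 0 ≤ B x) (nC : ∀ x, 0 ≤ C x)
    {i j : ℝ} (hi : 0 < i) (hj : 0 < j)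
    (hA : IsLUB (range A) (1 / i ^ 2)) (hB : IsLUB (range B) (1 / j ^ 2))
    (h : ∀ x y p q, 0 < p → 0 < q → A x = 1 / p ^ 2 → B y = 1 / q ^ 2 →
      1 / (p + q) ^ 2 ≤ C (x + y))
    (hC : ∀ s, 0 < s → OrdConnected {x | s < C x}) :
    ENNReal.ofReal (i ^ 2) * (∫⁻ x, ENNReal.ofReal (A x))
      + ENNReal.ofReal (j ^ 2) * (∫⁻ x, ENNReal.ofReal (B x))
      ≤ ENNReal.ofReal ((i + j) ^ 2) * ∫⁻ x, ENNReal.ofReal (C x) := by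
  have e : ∀ (c : ℝ) (g : ℝ → ℝ), Measurable g → 0 ≤ c → (∀ x, 0 ≤ g x) →
      ENNReal.ofReal c * (∫⁻ x, ENNReal.ofReal (g x))
        = ∫⁻ t in Ioi (0:ℝ), volume {x | t < c * g x} := by
    intro c g mg hc ng
    rw [← lintegral_eq_lintegral_meas_lt volume (Filter.Eventually.of_forall
        (fun x => mul_nonneg hc (ng x))) (mg.const_mul c).aemeasurable,
        ← lintegral_const_mul _ mg.ennreal_ofReal]
    simp_rw [ENNReal.ofReal_mul hc]
  rw [e _ A mA (by positivity) nA, e _ B mB (by positivity) nB, e _ C mC (by positivity) nC]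
  have hm : Measurable (fun t => volume {x | t < i ^ 2 * A x}) := by
    apply Antitone.measurable
    intro s t hst
    apply measure_mono
    intro x hx
    exact lt_of_le_of_lt hst hx
  rw [← lintegral_add_left hm]
  apply setLIntegral_mono' measurableSet_Ioi
  intro t ht
  have ht : 0 < t := ht
  by_cases ht1 : t < 1
  · apply bz_vol_add_le
    · have : t / i ^ 2 < 1 / i ^ 2 := by gcongr
      obtain ⟨_, ⟨x, rfl⟩, hx⟩ := (lt_isLUB_iff hA).1 this
      refine ⟨x, ?_⟩
      rw [div_lt_iff₀ (by positivity)] at hx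
      simpa [mul_comm] using hx
    · have : t / j ^ 2 < 1 / j ^ 2 := by gcongr
      obtain ⟨_, ⟨x, rfl⟩, hx⟩ := (lt_isLUB_iff hB).1 this
      refine ⟨x, ?_⟩
      rw [div_lt_iff₀ (by positivity)] at hx
      simpa [mul_comm] using hx
    · have := hC (t / (i + j) ^ 2) (by positivity)
      convert this using 3 with x
      rw [div_lt_iff₀ (by positivity), mul_comm]
    · intro x hx y hy
      simp only [mem_ofPred_eq] at hx hy ⊢
      have Ax : 0 < A x := by
        by_contra hc
        have : A x = 0 := le_antisymm (not_lt.1 hc) (nA x)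
        rw [this] at hx; simp at hx; linarith
      have By : 0 < B y := by
        by_contra hc
        have : B y = 0 := le_antisymm (not_lt.1 hc) (nB y)
        rw [this] at hy; simp at hy; linarith
      set p := 1 / √(A x) with hp
      set q := 1 / √(B y) with hq
      have p0 : 0 < p := by positivity
      have q0 : 0 < q := by positivity
      have hAx : A x = 1 / p ^ 2 := by rw [hp]; simp [Real.sq_sqrt Ax.le]
      have hBy : B y = 1 / q ^ 2 := by rw [hq]; simp [Real.sq_sqrt By.le]
      have hC1 := h x y p q p0 q0 hAx hBy
      set r := √t with hr
      have r0 : 0 < r := Real.sqrt_pos.2 ht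
      have hrt : t = r ^ 2 := (Real.sq_sqrt ht.le).symm
      have h1 : r * p < i := by
        rw [hAx, hrt, mul_one_div, lt_div_iff₀ (by positivity), ← mul_pow] at hx
        exact lt_of_pow_lt_pow_left₀ 2 hi.le hx
      have h2 : r * q < j := by
        rw [hBy, hrt, mul_one_div, lt_div_iff₀ (by positivity), ← mul_pow] at hy
        exact lt_of_pow_lt_pow_left₀ 2 hj.le hy
      refine lt_of_lt_of_le ?_ (mul_le_mul_of_nonneg_left hC1 (by positivity))
      rw [hrt, mul_one_div, lt_div_iff₀ (by positivity), ← mul_pow]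
      gcongr
      linarith
  · have hz : ∀ (k : ℝ) (g : ℝ → ℝ), 0 < k → IsLUB (range g) (1 / k ^ 2) →
        {x | t < k ^ 2 * g x} = ∅ := by
      intro k g hk hg
      ext x
      simp only [mem_ofPred_eq, mem_empty_iff_false, iff_false, not_lt]
      have := hg.1 ⟨x, rfl⟩
      rw [le_div_iff₀ (by positivity)] at this
      linarith
    rw [hz i A hi hA, hz j B hj hB]
    simp
end PartA

section PartB
open Set

structure BzConv (D : Set (ℝ × ℝ)) (φ : ℝ × ℝ → ℝ) : Prop where
  conv : ConvexOn ℝ D φ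
  negD : ∀ x ∈ D, -x ∈ D
  even : ∀ x, φ (-x) = φ x
  pos : 0 < φ 0
  bdd : ∃ η > 0, ∃ M, ∀ q : ℝ × ℝ, ‖q‖ ≤ η → q ∈ D ∧ φ q ≤ M

def bzDens (D : Set (ℝ × ℝ)) (φ : ℝ × ℝ → ℝ) (x : ℝ × ℝ) : ℝ :=
  if x ∈ D then 1 / (φ x) ^ 2 else 0

def bzRay (D : Set (ℝ × ℝ)) (φ : ℝ × ℝ → ℝ) (e : ℝ × ℝ) (ρ : ℝ) : ℝ :=
  if 0 < ρ then bzDens D φ (ρ⁻¹ • e) / ρ ^ 2 else 0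

variable {D : Set (ℝ × ℝ)} {φ : ℝ × ℝ → ℝ}

lemma bzDens_nonneg (x : ℝ × ℝ) : 0 ≤ bzDens D φ x := by
  unfold bzDens; split_ifs <;> positivity

lemma bzRay_nonneg (e : ℝ × ℝ) (x : ℝ) : 0 ≤ bzRay D φ e x := by
  unfold bzRay
  split_ifs
  · exact div_nonneg (bzDens_nonneg _) (by positivity)
  · exact le_rfl

lemma BzConv.zero_mem (h : BzConv D φ) : (0 : ℝ × ℝ) ∈ D := by
  obtain ⟨η, h0, M, hM⟩ := h.bdd
  exact (hM 0 (by simpa using h0.le)).1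

lemma BzConv.le (h : BzConv D φ) {x : ℝ × ℝ} (hx : x ∈ D) : φ 0 ≤ φ x := by
  have := h.conv.2 hx (h.negD x hx) (show (0:ℝ) ≤ 1/2 by norm_num)
    (show (0:ℝ) ≤ 1/2 by norm_num) (by norm_num)
  rw [h.even] at this
  simp only [smul_neg, add_neg_cancel, smul_eq_mul] at this
  linarith

lemma BzConv.phi_pos (h : BzConv D φ) {x : ℝ × ℝ} (hx : x ∈ D) : 0 < φ x :=
  lt_of_lt_of_le h.pos (h.le hx)

lemma BzConv.dens_neg (h : BzConv D φ) (x : ℝ × ℝ) : bzDens D φ (-x) = bzDens D φ x := by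
  have : -x ∈ D ↔ x ∈ D := ⟨fun hx => by simpa using h.negD _ hx, h.negD x⟩
  simp [bzDens, this, h.even]

lemma bzDens_mem {x : ℝ × ℝ} {s : ℝ} (hs : 0 ≤ s) (hx : s < bzDens D φ x) : x ∈ D := by
  by_contra hc
  simp [bzDens, hc] at hx
  linarith

lemma BzConv.level (h : BzConv D φ) (s : ℝ) : Convex ℝ {x | s < bzDens D φ x} := by
  rcases lt_or_ge s 0 with hs | hs
  · convert convex_univ using 1
    ext x
    simpa using lt_of_lt_of_le hs (bzDens_nonneg x)
  · intro x hx y hy a b ha hb hab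
    have hxD := bzDens_mem hs hx
    have hyD := bzDens_mem hs hy
    have hz := h.conv.1 hxD hyD ha hb hab
    have h1 := h.conv.2 hxD hyD ha hb hab
    change s < bzDens D φ x at hx
    change s < bzDens D φ y at hy
    change s < bzDens D φ (a • x + b • y)
    have h3 := h.phi_pos hz
    unfold bzDens at *
    rw [if_pos hxD] at hx
    rw [if_pos hyD] at hy
    rw [if_pos hz]
    have h2 : φ (a • x + b • y) ≤ max (φ x) (φ y) := by
      refine h1.trans ?_
      simp only [smul_eq_mul]
      calc _ ≤ a * max (φ x) (φ y) + b * max (φ x) (φ y) := by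
            gcongr <;> simp
        _ = _ := by rw [← add_mul, hab, one_mul]
    rcases le_max_iff.1 h2 with h4 | h4
    · refine hx.trans_le ?_; gcongr
    · refine hy.trans_le ?_; gcongr

lemma bz_meas_of_ordConnected {g : ℝ → ℝ} (h : ∀ s, OrdConnected {x | s < g x}) :
    Measurable g :=
  measurable_of_Ioi (fun s => (h s).measurableSet)

lemma BzConv.line_ord (h : BzConv D φ) (p e : ℝ × ℝ) (s : ℝ) :
    OrdConnected {r : ℝ | s < bzDens D φ (p + r • e)} := by
  apply Convex.ordConnected
  intro x hx y hy a b ha hb hab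
  have := h.level s hx hy ha hb hab
  change s < bzDens D φ (p + (a • x + b • y) • e)
  convert (show s < bzDens D φ _ from this) using 2
  have : p = (a + b) • p := by rw [hab, one_smul]
  conv_lhs => rw [this]
  simp only [smul_eq_mul]
  module

lemma BzConv.line_meas (h : BzConv D φ) (p e : ℝ × ℝ) :
    Measurable (fun r : ℝ => bzDens D φ (p + r • e)) :=
  bz_meas_of_ordConnected (h.line_ord p e)

lemma BzConv.persp (h : BzConv D φ) {e e' : ℝ × ℝ} {ρ σ : ℝ} (hρ : 0 < ρ) (hσ : 0 < σ)
    (he : ρ⁻¹ • e ∈ D) (he' : σ⁻¹ • e' ∈ D) :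
    (ρ + σ)⁻¹ • (e + e') ∈ D ∧
    (ρ + σ) * φ ((ρ + σ)⁻¹ • (e + e')) ≤ ρ * φ (ρ⁻¹ • e) + σ * φ (σ⁻¹ • e') := by
  have hs : 0 < ρ + σ := by positivity
  have e1 : (ρ + σ)⁻¹ • (e + e') = (ρ / (ρ + σ)) • (ρ⁻¹ • e) + (σ / (ρ + σ)) • (σ⁻¹ • e') := by
    rw [smul_smul, smul_smul, smul_add]
    congr 2 <;> field_simp
  have h1 : 0 ≤ ρ / (ρ + σ) := by positivity
  have h2 : 0 ≤ σ / (ρ + σ) := by positivity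
  have h3 : ρ / (ρ + σ) + σ / (ρ + σ) = 1 := by field_simp
  rw [e1]
  refine ⟨h.conv.1 he he' h1 h2 h3, ?_⟩
  have := h.conv.2 he he' h1 h2 h3
  calc _ ≤ (ρ + σ) * ((ρ / (ρ + σ)) • φ (ρ⁻¹ • e) + (σ / (ρ + σ)) • φ (σ⁻¹ • e')) := by gcongr
    _ = _ := by simp only [smul_eq_mul]; field_simp

lemma BzConv.ray_eq (h : BzConv D φ) {e : ℝ × ℝ} {ρ : ℝ} (hρ : 0 < ρ) (he : ρ⁻¹ • e ∈ D) :
    bzRay D φ e ρ = 1 / (ρ * φ (ρ⁻¹ • e)) ^ 2 := by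
  simp only [bzRay, hρ, if_true, bzDens, he]
  have := h.phi_pos he
  field_simp

lemma bzRay_mem {e : ℝ × ℝ} {ρ s : ℝ} (hs : 0 ≤ s) (hx : s < bzRay D φ e ρ) :
    0 < ρ ∧ ρ⁻¹ • e ∈ D := by
  have hρ : 0 < ρ := by
    by_contra hc
    simp [bzRay, hc] at hx
    linarith
  refine ⟨hρ, ?_⟩
  by_contra hc
  simp [bzRay, bzDens, hc] at hx
  linarith

lemma BzConv.ray_ord (h : BzConv D φ) (e : ℝ × ℝ) (s : ℝ) :
    OrdConnected {r : ℝ | s < bzRay D φ e r} := by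
  rcases lt_or_ge s 0 with hs | hs
  · convert ordConnected_univ using 1
    ext x
    simpa using lt_of_lt_of_le hs (bzRay_nonneg e x)
  apply Convex.ordConnected
  rw [convex_iff_forall_pos]
  intro x hx y hy a b ha hb hab
  change s < bzRay D φ e x at hx
  change s < bzRay D φ e y at hy
  obtain ⟨x0, hxD⟩ := bzRay_mem hs hx
  obtain ⟨y0, hyD⟩ := bzRay_mem hs hy
  have ax : (a * x)⁻¹ • (a • e) = x⁻¹ • e := by
    rw [smul_smul]; congr 1; field_simp
  have by' : (b * y)⁻¹ • (b • e) = y⁻¹ • e := by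
    rw [smul_smul]; congr 1; field_simp
  have := h.persp (mul_pos ha x0) (mul_pos hb y0) (by rwa [ax]) (by rwa [by'])
  rw [ax, by', ← add_smul, hab, one_smul] at this
  obtain ⟨hz, h1⟩ := this
  have hz0 : 0 < a * x + b * y := by positivity
  change s < bzRay D φ e (a * x + b * y)
  rw [h.ray_eq hz0 hz]
  rw [h.ray_eq x0 hxD] at hx
  rw [h.ray_eq y0 hyD] at hy
  have p1 := h.phi_pos hxD
  have p2 := h.phi_pos hyD
  have p3 := h.phi_pos hz
  have h2 : (a * x + b * y) * φ ((a * x + b * y)⁻¹ • e)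
      ≤ max (x * φ (x⁻¹ • e)) (y * φ (y⁻¹ • e)) := by
    refine h1.trans ?_
    rw [mul_assoc, mul_assoc]
    calc _ ≤ a * max (x * φ (x⁻¹ • e)) (y * φ (y⁻¹ • e))
          + b * max (x * φ (x⁻¹ • e)) (y * φ (y⁻¹ • e)) := by gcongr <;> simp
      _ = _ := by rw [← add_mul, hab, one_mul]
  rcases le_max_iff.1 h2 with h4 | h4
  · refine hx.trans_le ?_; gcongr
  · refine hy.trans_le ?_; gcongr

lemma BzConv.ray_meas (h : BzConv D φ) (e : ℝ × ℝ) : Measurable (bzRay D φ e) :=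
  bz_meas_of_ordConnected (h.ray_ord e)

lemma bzRay_lintegral (e : ℝ × ℝ) : ∫⁻ x, ENNReal.ofReal (bzRay D φ e x)
    = ∫⁻ r in Ioi (0:ℝ), ENNReal.ofReal (bzDens D φ (r • e)) := by
  have himg : (fun x : ℝ => x⁻¹) '' Ioi 0 = Ioi 0 := by
    ext x
    simp only [mem_image, mem_Ioi]
    exact ⟨by rintro ⟨y, hy, rfl⟩; positivity, fun hx => ⟨x⁻¹, by positivity, by simp⟩⟩
  have := lintegral_image_eq_lintegral_abs_deriv_mul (s := Ioi 0) (f := fun x : ℝ => x⁻¹)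
    (f' := fun x => -(x ^ 2)⁻¹) measurableSet_Ioi
    (fun x hx => (hasDerivAt_inv (ne_of_gt hx)).hasDerivWithinAt)
    (fun x _ y _ hxy => inv_injective hxy) (fun r => ENNReal.ofReal (bzDens D φ (r • e)))
  rw [himg] at this
  rw [this, ← lintegral_indicator measurableSet_Ioi]
  congr 1
  ext x
  by_cases hx : 0 < x
  · rw [indicator_of_mem (by exact hx), ← ENNReal.ofReal_mul (abs_nonneg _)]
    congr 1
    simp only [bzRay, hx, if_true, abs_neg]
    rw [abs_of_pos (by positivity)]
    field_simp
  · rw [indicator_of_notMem (by exact hx)]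
    simp [bzRay, hx]

lemma BzConv.lintegral_half (h : BzConv D φ) (e : ℝ × ℝ) :
    ∫⁻ r : ℝ, ENNReal.ofReal (bzDens D φ (r • e))
      = 2 * ∫⁻ r in Ioi (0:ℝ), ENNReal.ofReal (bzDens D φ (r • e)) := by
  have h1 := lintegral_add_compl (μ := volume)
    (fun r : ℝ => ENNReal.ofReal (bzDens D φ (r • e))) (measurableSet_Ioi (a := (0:ℝ)))
  rw [← h1, two_mul]
  congr 1
  rw [compl_Ioi, ← setLIntegral_congr (Iio_ae_eq_Iic (μ := volume) (a := (0:ℝ)))]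
  have h2 := (Measure.measurePreserving_neg (volume : Measure ℝ)).setLIntegral_comp_emb
    (MeasurableEquiv.neg ℝ).measurableEmbedding
    (fun r : ℝ => ENNReal.ofReal (bzDens D φ (r • e))) (Ioi 0)
  have h3 : (fun x : ℝ => -x) '' Ioi 0 = Iio 0 := by simp
  have h4 : (Neg.neg : ℝ → ℝ) '' Ioi 0 = Iio 0 := h3
  rw [h4] at h2
  rw [← h2]
  simp_rw [neg_smul, h.dens_neg]

lemma BzConv.ray_pos (h : BzConv D φ) (e : ℝ × ℝ) : ∃ ρ, 0 < bzRay D φ e ρ := by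
  obtain ⟨η, h0, M, hM⟩ := h.bdd
  have hρ : 0 < (‖e‖ + 1) / η := by positivity
  refine ⟨(‖e‖ + 1) / η, ?_⟩
  have : ((‖e‖ + 1) / η)⁻¹ • e ∈ D := by
    refine (hM _ ?_).1
    rw [norm_smul, Real.norm_of_nonneg (by positivity), inv_div, div_mul_eq_mul_div,
      div_le_iff₀ (by positivity)]
    gcongr
    linarith
  rw [h.ray_eq hρ this]
  have := h.phi_pos this
  positivity

lemma BzConv.ray_bdd (h : BzConv D φ) (e : ℝ × ℝ)
    (hf : ∫⁻ r : ℝ, ENNReal.ofReal (bzDens D φ (r • e)) ≠ ⊤) :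
    BddAbove (range (bzRay D φ e)) := by
  have hex : ∃ r₀ : ℝ, 0 < r₀ ∧ (r₀ • e ∈ D → φ 0 < φ (r₀ • e)) := by
    by_contra hc
    push Not at hc
    apply hf
    rw [h.lintegral_half]
    have : ∫⁻ r in Ioi (0:ℝ), ENNReal.ofReal (bzDens D φ (r • e))
        = ∫⁻ r in Ioi (0:ℝ), ENNReal.ofReal (1 / φ 0 ^ 2) := by
      apply setLIntegral_congr_fun measurableSet_Ioi
      intro r hr
      obtain ⟨h1, h2⟩ := hc r hr
      simp only [bzDens, h1, if_true]
      rw [le_antisymm h2 (h.le h1)]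
    rw [this]
    have := h.pos
    simp
    rw [ENNReal.mul_top]
    · simp
    · simp; positivity
  obtain ⟨r₀, h0, hr₀⟩ := hex
  set m := if r₀ • e ∈ D then min (φ 0 / r₀) ((φ (r₀ • e) - φ 0) / r₀) else φ 0 / r₀ with hm
  have hp := h.pos
  have m0 : 0 < m := by
    rw [hm]
    split_ifs with hD
    · have := hr₀ hD
      have : 0 < φ (r₀ • e) - φ 0 := by linarith
      positivity
    · positivity
  refine ⟨1 / m ^ 2, ?_⟩
  rintro _ ⟨ρ, rfl⟩
  by_cases hpos : 0 < bzRay D φ e ρ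
  swap
  · exact (not_lt.1 hpos).trans (by positivity)
  obtain ⟨ρ0, hD⟩ := bzRay_mem le_rfl hpos
  rw [h.ray_eq ρ0 hD]
  have hle : m ≤ ρ * φ (ρ⁻¹ • e) := by
    rcases le_total ρ⁻¹ r₀ with hc | hc
    · have h1 : m ≤ φ 0 / r₀ := by
        rw [hm]; split_ifs
        · exact min_le_left _ _
        · exact le_rfl
      refine h1.trans ?_
      rw [div_eq_inv_mul]
      have : r₀⁻¹ ≤ ρ := inv_le_of_inv_le₀ ρ0 hc
      have := h.le hD
      gcongr
    · have hz := h.zero_mem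
      have ha : 0 ≤ r₀ * ρ := by positivity
      have hb : 0 ≤ 1 - r₀ * ρ := by
        rw [← one_div, le_div_iff₀ ρ0] at hc
        linarith
      have e1 : (r₀ * ρ) • (ρ⁻¹ • e) + (1 - r₀ * ρ) • (0 : ℝ × ℝ) = r₀ • e := by
        rw [smul_zero, add_zero, smul_smul]; congr 1; field_simp
      have hD0 := h.conv.1 hD hz ha hb (by ring)
      have h2 := h.conv.2 hD hz ha hb (by ring)
      rw [e1] at hD0 h2
      have h1 : m ≤ (φ (r₀ • e) - φ 0) / r₀ := by
        rw [hm, if_pos hD0]; exact min_le_right _ _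
      refine h1.trans ?_
      rw [div_le_iff₀ h0]
      simp only [smul_eq_mul] at h2
      nlinarith [mul_nonneg ha hp.le]
  gcongr

lemma BzConv.busemann (h : BzConv D φ) (e e' : ℝ × ℝ)
    (hf : ∫⁻ r : ℝ, ENNReal.ofReal (bzDens D φ (r • e)) ≠ ⊤)
    (hf' : ∫⁻ r : ℝ, ENNReal.ofReal (bzDens D φ (r • e')) ≠ ⊤)
    (hf'' : ∫⁻ r : ℝ, ENNReal.ofReal (bzDens D φ (r • (e + e'))) ≠ ⊤) :
    (∫⁻ r : ℝ, ENNReal.ofReal (bzDens D φ (r • e))).toReal *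
    (∫⁻ r : ℝ, ENNReal.ofReal (bzDens D φ (r • e'))).toReal ≤
    ((∫⁻ r : ℝ, ENNReal.ofReal (bzDens D φ (r • e))).toReal +
    (∫⁻ r : ℝ, ENNReal.ofReal (bzDens D φ (r • e'))).toReal) *
    (∫⁻ r : ℝ, ENNReal.ofReal (bzDens D φ (r • (e + e')))).toReal := by
  have lub : ∀ e : ℝ × ℝ, ∫⁻ r : ℝ, ENNReal.ofReal (bzDens D φ (r • e)) ≠ ⊤ →
      ∃ i, 0 < i ∧ IsLUB (range (bzRay D φ e)) (1 / i ^ 2) := by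
    intro e he
    have h1 := isLUB_csSup (range_nonempty _) (h.ray_bdd e he)
    obtain ⟨ρ, hρ⟩ := h.ray_pos e
    have h2 : 0 < sSup (range (bzRay D φ e)) := hρ.trans_le (h1.1 ⟨ρ, rfl⟩)
    refine ⟨1 / √(sSup (range (bzRay D φ e))), by positivity, ?_⟩
    have h3 : 1 / (1 / √(sSup (range (bzRay D φ e)))) ^ 2 = sSup (range (bzRay D φ e)) := by
      rw [div_pow, Real.sq_sqrt h2.le]; simp
    rw [h3]; exact h1
  obtain ⟨i, hi, hil⟩ := lub e hf
  obtain ⟨j, hj, hjl⟩ := lub e' hf'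
  have key := bz_bbl (h.ray_meas e) (h.ray_meas e') (h.ray_meas (e + e')) (bzRay_nonneg e)
    (bzRay_nonneg e') (bzRay_nonneg _) hi hj hil hjl ?_ (fun s _ => h.ray_ord _ s)
  · rw [h.lintegral_half] at hf hf' hf'' ⊢
    rw [h.lintegral_half e', h.lintegral_half (e + e')]
    rw [bzRay_lintegral, bzRay_lintegral, bzRay_lintegral] at key
    generalize ∫⁻ r in Ioi (0:ℝ), ENNReal.ofReal (bzDens D φ (r • e)) = a at *
    generalize ∫⁻ r in Ioi (0:ℝ), ENNReal.ofReal (bzDens D φ (r • e')) = b at *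
    generalize ∫⁻ r in Ioi (0:ℝ), ENNReal.ofReal (bzDens D φ (r • (e + e'))) = c at *
    have fin : ∀ x : ℝ≥0∞, 2 * x ≠ ⊤ → x ≠ ⊤ := by
      rintro x hx rfl
      exact hx (by simp [ENNReal.mul_top])
    have fa := fin a hf
    have fb := fin b hf'
    have fc := fin c hf''
    lift a to NNReal using fa
    lift b to NNReal using fb
    lift c to NNReal using fc
    have key2 := ENNReal.toReal_mono (by finiteness) key
    rw [ENNReal.toReal_add (by finiteness) (by finiteness)] at key2
    simp only [ENNReal.toReal_mul, ENNReal.coe_toReal,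
      ENNReal.toReal_ofReal (sq_nonneg _), ENNReal.toReal_ofNat] at key2 ⊢
    have a0 : (0:ℝ) ≤ (a : ℝ) := a.coe_nonneg
    have b0 : (0:ℝ) ≤ (b : ℝ) := b.coe_nonneg
    have c0 : (0:ℝ) ≤ (c : ℝ) := c.coe_nonneg
    generalize (a : ℝ) = a' at *
    generalize (b : ℝ) = b' at *
    generalize (c : ℝ) = c' at *
    have h1 : (i + j) ^ 2 * (a' * b') ≤ (i + j) ^ 2 * ((a' + b') * c') := by
      have : 0 ≤ a' + b' := add_nonneg a0 b0
      nlinarith [mul_le_mul_of_nonneg_left key2 this, sq_nonneg (i * a' - j * b')]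
    have h2 := le_of_mul_le_mul_left h1 (by positivity)
    nlinarith
  · intro x y p q hp hq hx hy
    obtain ⟨x0, hxD⟩ := bzRay_mem (D := D) (φ := φ) (e := e) (ρ := x) le_rfl (by rw [hx]; positivity)
    obtain ⟨y0, hyD⟩ := bzRay_mem (D := D) (φ := φ) (e := e') (ρ := y) le_rfl (by rw [hy]; positivity)
    obtain ⟨hz, hle⟩ := h.persp x0 y0 hxD hyD
    rw [h.ray_eq x0 hxD] at hx
    rw [h.ray_eq y0 hyD] at hy
    rw [h.ray_eq (add_pos x0 y0) hz]
    have p1 := h.phi_pos hxD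
    have p2 := h.phi_pos hyD
    have p3 := h.phi_pos hz
    have inj : ∀ s t : ℝ, 0 < s → 0 < t → 1 / s ^ 2 = 1 / t ^ 2 → s = t := by
      intro s t hs ht hst
      rw [one_div, one_div, inv_inj] at hst
      exact (pow_left_inj₀ hs.le ht.le two_ne_zero).1 hst
    rw [inj _ _ (by positivity) hp hx, inj _ _ (by positivity) hq hy] at hle
    gcongr

end PartB

section PartC
open Set Filter Topology

variable {D : Set (ℝ × ℝ)} {φ : ℝ × ℝ → ℝ}

def bzI (D : Set (ℝ × ℝ)) (φ : ℝ × ℝ → ℝ) (x : ℝ) : ℝ≥0∞ :=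
  ∫⁻ y : ℝ, ENNReal.ofReal (bzDens D φ (x, y))

lemma BzConv.sec_meas (h : BzConv D φ) (x : ℝ) : Measurable (fun y : ℝ => bzDens D φ (x, y)) := by
  have := h.line_meas (x, 0) (0, 1)
  simpa using this

lemma BzConv.sec_ord (h : BzConv D φ) (x s : ℝ) : OrdConnected {y : ℝ | s < bzDens D φ (x, y)} := by
  have := h.line_ord (x, 0) (0, 1) s
  simpa using this

lemma BzConv.I_le (h : BzConv D φ) (x : ℝ) : bzI D φ x ≤ bzI D φ 0 := by
  unfold bzI
  rw [lintegral_eq_lintegral_meas_lt volume (Eventually.of_forall fun y => bzDens_nonneg _)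
      (h.sec_meas x).aemeasurable,
    lintegral_eq_lintegral_meas_lt volume (Eventually.of_forall fun y => bzDens_nonneg _)
      (h.sec_meas 0).aemeasurable]
  apply lintegral_mono
  intro s
  apply bz_vol_half_le (h.sec_ord 0 s)
  intro a ha b hb
  have hb' : s < bzDens D φ (-(x, b)) := by rw [h.dens_neg]; exact hb
  have := h.level s (show (x, a) ∈ {z | s < bzDens D φ z} from ha) hb'
    (show (0:ℝ) ≤ 1/2 by norm_num) (show (0:ℝ) ≤ 1/2 by norm_num) (by norm_num)
  change s < bzDens D φ (0, (a - b) / 2)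
  convert (show s < bzDens D φ _ from this) using 2
  ext <;> simp
  ring

lemma BzConv.I_ge (h : BzConv D φ) : ∃ η > 0, ∃ K ≥ 0, ∀ δ : ℝ, 0 < δ → δ < 1 → ∀ c, |c| ≤ δ * η →
    ENNReal.ofReal ((1 - δ) / (1 + δ * K) ^ 2) * bzI D φ 0 ≤ bzI D φ c := by
  obtain ⟨η, h0, M, hM⟩ := h.bdd
  have hp := h.pos
  have hM0 : φ 0 ≤ M := (hM 0 (by simpa using h0.le)).2
  have hMp : 0 < M := hp.trans_le hM0
  refine ⟨η, h0, M / φ 0, by positivity, ?_⟩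
  intro δ hδ hδ1 c hc
  have h1δ : 0 < 1 - δ := by linarith
  have hsub : bzI D φ c = ∫⁻ y : ℝ, ENNReal.ofReal (1 - δ) *
      ENNReal.ofReal (bzDens D φ (c, (1 - δ) * y)) := by
    have := lintegral_image_eq_lintegral_abs_deriv_mul (s := univ) (f := fun x : ℝ => (1 - δ) * x)
      (f' := fun x => (1 - δ)) MeasurableSet.univ
      (fun x hx => by simpa using ((hasDerivAt_id x).const_mul (1 - δ)))
      (fun x _ y _ hxy => mul_left_cancel₀ h1δ.ne' hxy)
      (fun y => ENNReal.ofReal (bzDens D φ (c, y)))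
    have hs : (fun x : ℝ => (1 - δ) * x) '' univ = univ := by
      rw [image_univ]
      exact (mul_left_surjective₀ h1δ.ne').range_eq
    rw [hs] at this
    simpa [abs_of_pos h1δ, bzI] using this
  rw [hsub]
  unfold bzI
  rw [← lintegral_const_mul _ (h.sec_meas 0).ennreal_ofReal]
  apply lintegral_mono
  intro y
  dsimp only
  rw [← ENNReal.ofReal_mul (by positivity), ← ENNReal.ofReal_mul (by positivity)]
  apply ENNReal.ofReal_le_ofReal
  by_cases hy : ((0:ℝ), y) ∈ D
  · have hq := hM (c / δ, 0) (by
      simp only [Prod.norm_mk, norm_zero, Real.norm_eq_abs, abs_div, abs_of_pos hδ]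
      rw [max_eq_left (by positivity), div_le_iff₀ hδ]; linarith)
    have e1 : ((c, (1 - δ) * y) : ℝ × ℝ) = (1 - δ) • ((0:ℝ), y) + δ • (c / δ, (0:ℝ)) := by
      ext <;> simp
      field_simp
    have hz := h.conv.1 hy hq.1 h1δ.le hδ.le (by ring)
    have hle := h.conv.2 hy hq.1 h1δ.le hδ.le (by ring)
    rw [← e1] at hz hle
    simp only [bzDens, hy, hz, if_true]
    have pz := h.phi_pos hz
    have py := h.phi_pos hy
    have ly := h.le hy
    have : φ (c, (1 - δ) * y) ≤ (1 + δ * (M / φ 0)) * φ (0, y) := by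
      refine hle.trans ?_
      simp only [smul_eq_mul]
      have h2 : M ≤ M / φ 0 * φ (0, y) := by
        rw [div_mul_eq_mul_div, le_div_iff₀ hp]; gcongr
      nlinarith [hq.2]
    rw [div_mul_div_comm, mul_one, ← mul_pow, div_eq_mul_one_div]
    gcongr
  · simp only [bzDens, hy, if_false, mul_zero]
    exact mul_nonneg h1δ.le (bzDens_nonneg _)

lemma bz_exists_ae {p : ℝ → Prop} (hp : ∀ᵐ x, p x) {r : ℝ} (hr : 0 < r) : ∃ c, |c| ≤ r ∧ p c := by
  by_contra hc
  push Not at hc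
  have h1 : Icc (-r) r ⊆ {x | ¬ p x} := fun x hx => hc x (abs_le.2 hx)
  have h2 := measure_mono_null h1 (ae_iff.1 hp)
  rw [Real.volume_Icc] at h2
  simp at h2
  linarith

lemma BzConv.marginal (h : BzConv D φ)
    (hm : AEMeasurable (fun z => ENNReal.ofReal (bzDens D φ z)) volume)
    (h1 : ∫⁻ z, ENNReal.ofReal (bzDens D φ z) = 1)
    (u : ℝ → ℝ) (mu : Measurable u) (nu : ∀ x, 0 ≤ u x)
    (hu : (volume.withDensity (fun z => ENNReal.ofReal (bzDens D φ z))).map Prod.fst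
      = volume.withDensity (fun x => ENNReal.ofReal (u x))) :
    eLpNorm u ⊤ volume = bzI D φ 0 ∧ bzI D φ 0 ≠ ⊤ ∧ bzI D φ 0 ≠ 0 := by
  rw [Measure.volume_eq_prod] at hm h1 hu
  have hImeas : AEMeasurable (bzI D φ) volume := hm.lintegral_prod_right'
  have hI1 : ∫⁻ x, bzI D φ x = 1 := by
    rw [← h1, lintegral_prod _ hm]; rfl
  have hwd : Measure.map Prod.fst (((volume : Measure ℝ).prod (volume : Measure ℝ)).withDensity
      (fun z => ENNReal.ofReal (bzDens D φ z))) = volume.withDensity (bzI D φ) := by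
    ext s hs
    rw [Measure.map_apply measurable_fst hs, withDensity_apply _ (measurable_fst hs),
      withDensity_apply _ hs]
    have e : (Prod.fst ⁻¹' s : Set (ℝ × ℝ)) = s ×ˢ univ := by ext; simp
    rw [e, ← Measure.prod_restrict, lintegral_prod]
    · simp only [Measure.restrict_univ]; rfl
    · rw [Measure.prod_restrict]; exact hm.restrict
  rw [hwd] at hu
  have hae : bzI D φ =ᵐ[volume] (fun x => ENNReal.ofReal (u x)) :=
    (withDensity_eq_iff hImeas mu.ennreal_ofReal.aemeasurable (by rw [hI1]; simp)).1 hu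
  obtain ⟨η, hη, K, hK, hge⟩ := h.I_ge
  have hfin : bzI D φ 0 ≠ ⊤ := by
    have h2 := ae_lt_top' hImeas (by rw [hI1]; simp)
    obtain ⟨c, hc, hlt⟩ := bz_exists_ae h2 (show 0 < (1/2:ℝ) * η by positivity)
    have h3 := hge (1/2) (by norm_num) (by norm_num) c hc
    intro htop
    rw [htop, ENNReal.mul_top] at h3
    · exact absurd hlt (not_lt.2 h3)
    · simp only [ne_eq, ENNReal.ofReal_eq_zero, not_le]
      positivity
  have hS : eLpNorm u ⊤ volume = essSup (bzI D φ) volume := by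
    rw [eLpNorm_exponent_top, eLpNormEssSup]
    apply essSup_congr_ae
    filter_upwards [hae] with x hx
    rw [hx, Real.enorm_of_nonneg (nu x)]
  refine ⟨?_, hfin, ?_⟩
  · rw [hS]
    apply le_antisymm
    · exact essSup_le_of_ae_le _ (Eventually.of_forall h.I_le)
    · have hk : ∀ δ : ℝ, 0 < δ → δ < 1 →
          ENNReal.ofReal ((1 - δ) / (1 + δ * K) ^ 2) * bzI D φ 0 ≤ essSup (bzI D φ) volume := by
        intro δ hδ hδ1
        obtain ⟨c, hc, hlt⟩ := bz_exists_ae (ENNReal.ae_le_essSup (bzI D φ) (μ := volume))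
          (show 0 < δ * η by positivity)
        exact (hge δ hδ hδ1 c hc).trans hlt
      have ht : Tendsto (fun δ : ℝ => ENNReal.ofReal ((1 - δ) / (1 + δ * K) ^ 2) * bzI D φ 0)
          (𝓝[>] 0) (𝓝 (1 * bzI D φ 0)) := by
        apply ENNReal.Tendsto.mul_const _ (Or.inr hfin)
        rw [← ENNReal.ofReal_one]
        apply ENNReal.tendsto_ofReal
        have hc : ContinuousAt (fun δ : ℝ => (1 - δ) / (1 + δ * K) ^ 2) 0 := by
          apply ContinuousAt.div
          · fun_prop
          · fun_prop
          · simp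
        have := hc.tendsto
        simp only [sub_zero, zero_mul, add_zero, one_pow, div_one] at this
        exact this.mono_left nhdsWithin_le_nhds
      rw [one_mul] at ht
      apply le_of_tendsto ht
      filter_upwards [Ioo_mem_nhdsGT (show (0:ℝ) < 1 by norm_num)] with δ hδ
      exact hk δ hδ.1 hδ.2
  · intro h0
    have : ∀ x, bzI D φ x = 0 := fun x => le_antisymm (h0 ▸ h.I_le x) (zero_le)
    simp [this] at hI1

end PartC

section PartD
open Set Filter Topology Metric

def bzE (μ : Measure (ℝ × ℝ)) : Set ((ℝ × ℝ) × ℝ) :=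
  {p | 0 < p.2 ∧ ∀ᶠ ρ in 𝓝[>] (0:ℝ), ENNReal.ofReal (4 * ρ ^ 2) ≤ μ (closedBall p.1 (p.2 * ρ))}

def bzD (μ : Measure (ℝ × ℝ)) : Set (ℝ × ℝ) := {x | ∃ a, (x, a) ∈ bzE μ}

def bzPhi (μ : Measure (ℝ × ℝ)) (x : ℝ × ℝ) : ℝ := sInf {a | (x, a) ∈ bzE μ}

variable {μ : Measure (ℝ × ℝ)}

lemma bz_vol_ball (x : ℝ × ℝ) {r : ℝ} (hr : 0 ≤ r) :
    volume (closedBall x r) = ENNReal.ofReal (4 * r ^ 2) := by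
  rw [← Prod.mk.eta (p := x), ← closedBall_prod_same, Measure.volume_eq_prod, Measure.prod_prod,
    Real.volume_closedBall, Real.volume_closedBall, ← ENNReal.ofReal_mul (by positivity)]
  congr 1; ring

lemma bzE_convex (hq : ∀ A B : Set (ℝ × ℝ), MeasurableSet A → MeasurableSet B → ∀ t : ℝ,
      t ∈ Icc (0:ℝ) 1 → min (μ A) (μ B) ≤ μ ((1 - t) • A + t • B)) : Convex ℝ (bzE μ) := by
  rw [convex_iff_forall_pos]
  rintro ⟨x, r⟩ ⟨hr, hx⟩ ⟨y, s⟩ ⟨hs, hy⟩ a b ha hb hab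
  refine ⟨by change 0 < a * r + b * s; simp only at hr hs; positivity, ?_⟩
  filter_upwards [hx, hy] with ρ h1 h2
  refine (le_min h1 h2).trans ((hq _ _ measurableSet_closedBall measurableSet_closedBall b
    ⟨hb.le, by linarith⟩).trans ?_)
  apply measure_mono
  have ea : 1 - b = a := by linarith
  rw [ea]
  rintro _ ⟨_, ⟨p, hp, rfl⟩, _, ⟨q, hq', rfl⟩, rfl⟩
  simp only [mem_closedBall, dist_eq_norm] at hp hq' ⊢
  change ‖a • p + b • q - (a • x + b • y)‖ ≤ (a * r + b * s) * ρ
  have e : a • p + b • q - (a • x + b • y) = a • (p - x) + b • (q - y) := by module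
  rw [e]
  refine (norm_add_le _ _).trans ?_
  rw [norm_smul, norm_smul, Real.norm_of_nonneg ha.le, Real.norm_of_nonneg hb.le]
  nlinarith

lemma bzE_mono {x : ℝ × ℝ} {a b : ℝ} (h : (x, a) ∈ bzE μ) (hab : a ≤ b) : (x, b) ∈ bzE μ := by
  obtain ⟨h1, h2⟩ := h
  refine ⟨lt_of_lt_of_le h1 hab, ?_⟩
  filter_upwards [h2, self_mem_nhdsWithin] with ρ h3 h4
  refine h3.trans (measure_mono (closedBall_subset_closedBall ?_))
  exact mul_le_mul_of_nonneg_right hab (le_of_lt h4)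

lemma bz_bddBelow (x : ℝ × ℝ) : BddBelow {a | (x, a) ∈ bzE μ} := ⟨0, fun _ ha => ha.1.le⟩

lemma bzPhi_nonneg (x : ℝ × ℝ) : 0 ≤ bzPhi μ x := Real.sInf_nonneg (fun _ ha => ha.1.le)

lemma bz_convexOn (hE : Convex ℝ (bzE μ)) : ConvexOn ℝ (bzD μ) (bzPhi μ) := by
  constructor
  · rintro x ⟨r, hx⟩ y ⟨s, hy⟩ a b ha hb hab
    exact ⟨_, hE hx hy ha hb hab⟩
  · rintro x hx y hy a b ha hb hab
    apply le_of_forall_pos_le_add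
    intro ε hε
    obtain ⟨r, hr, hr'⟩ := exists_lt_of_csInf_lt (s := {a | (x, a) ∈ bzE μ}) hx
      (show sInf {a | (x, a) ∈ bzE μ} < bzPhi μ x + ε by unfold bzPhi; linarith)
    obtain ⟨s, hs, hs'⟩ := exists_lt_of_csInf_lt (s := {a | (y, a) ∈ bzE μ}) hy
      (show sInf {a | (y, a) ∈ bzE μ} < bzPhi μ y + ε by unfold bzPhi; linarith)
    have h1 : bzPhi μ (a • x + b • y) ≤ a * r + b * s :=
      csInf_le (bz_bddBelow _) (hE hr hs ha hb hab)
    refine h1.trans ?_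
    simp only [smul_eq_mul]
    have : ε = a * ε + b * ε := by rw [← add_mul, hab, one_mul]
    rw [this]
    nlinarith [mul_le_mul_of_nonneg_left hr'.le ha, mul_le_mul_of_nonneg_left hs'.le hb]

lemma bzE_neg (hsymm : Measure.map (fun z : ℝ × ℝ => -z) μ = μ) (x : ℝ × ℝ) (a : ℝ) :
    (-x, a) ∈ bzE μ ↔ (x, a) ∈ bzE μ := by
  have : ∀ r, μ (closedBall (-x) r) = μ (closedBall x r) := by
    intro r
    conv_lhs => rw [← hsymm]
    rw [Measure.map_apply measurable_neg measurableSet_closedBall]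
    congr 1
    ext z
    simp only [mem_preimage, mem_closedBall, dist_neg_neg]
  simp only [bzE, mem_ofPred_eq, this]

lemma bz_ratio_iff (x : ℝ × ℝ) {a ρ : ℝ} (ha : 0 < a) (hρ : 0 < ρ) :
    ENNReal.ofReal (4 * ρ ^ 2) ≤ μ (closedBall x (a * ρ)) ↔
    ENNReal.ofReal (1 / a ^ 2) ≤ μ (closedBall x (a * ρ)) / volume (closedBall x (a * ρ)) := by
  rw [bz_vol_ball x (by positivity), ENNReal.le_div_iff_mul_le
    (Or.inl (ENNReal.ofReal_pos.2 (by positivity)).ne') (Or.inl ENNReal.ofReal_ne_top),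
    ← ENNReal.ofReal_mul (by positivity)]
  have : 1 / a ^ 2 * (4 * (a * ρ) ^ 2) = 4 * ρ ^ 2 := by field_simp
  rw [this]

lemma bz_tendsto_mul {a : ℝ} (ha : 0 < a) : Tendsto (fun ρ : ℝ => a * ρ) (𝓝[>] 0) (𝓝[>] 0) := by
  apply tendsto_nhdsWithin_iff.2
  constructor
  · have : Tendsto (fun ρ : ℝ => a * ρ) (𝓝 0) (𝓝 (a * 0)) := by
      apply Continuous.tendsto; fun_prop
    rw [mul_zero] at this
    exact this.mono_left nhdsWithin_le_nhds
  · filter_upwards [self_mem_nhdsWithin] with ρ hρ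
    exact mul_pos ha hρ

lemma bz_le_of_mem {x : ℝ × ℝ} {d : ℝ≥0∞} {a : ℝ}
    (hd : Tendsto (fun r => μ (closedBall x r) / volume (closedBall x r)) (𝓝[>] 0) (𝓝 d))
    (h : (x, a) ∈ bzE μ) : ENNReal.ofReal (1 / a ^ 2) ≤ d := by
  have h1 := hd.comp (bz_tendsto_mul h.1)
  apply ge_of_tendsto h1
  filter_upwards [h.2, self_mem_nhdsWithin] with ρ h2 h3
  exact (bz_ratio_iff x h.1 h3).1 h2

lemma bz_mem_of_lt {x : ℝ × ℝ} {d : ℝ≥0∞} {a : ℝ}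
    (hd : Tendsto (fun r => μ (closedBall x r) / volume (closedBall x r)) (𝓝[>] 0) (𝓝 d))
    (ha : 0 < a) (h : ENNReal.ofReal (1 / a ^ 2) < d) : (x, a) ∈ bzE μ := by
  have h1 := hd.comp (bz_tendsto_mul ha)
  refine ⟨ha, ?_⟩
  filter_upwards [h1.eventually (lt_mem_nhds h), self_mem_nhdsWithin] with ρ h2 h3
  exact (bz_ratio_iff x ha h3).2 (le_of_lt h2)

lemma bz_dens_eq {x : ℝ × ℝ} {d : ℝ≥0∞}
    (hd : Tendsto (fun r => μ (closedBall x r) / volume (closedBall x r)) (𝓝[>] 0) (𝓝 d))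
    (hdt : d < ⊤) : ENNReal.ofReal (bzDens (bzD μ) (bzPhi μ) x) = d ∧
      (x ∈ bzD μ → 0 < bzPhi μ x) := by
  rcases eq_or_ne d 0 with h0 | h0
  · have hx : x ∉ bzD μ := by
      rintro ⟨a, ha⟩
      have := bz_le_of_mem hd ha
      have ha0 : 0 < a := ha.1
      rw [h0] at this
      simp only [nonpos_iff_eq_zero, ENNReal.ofReal_eq_zero] at this
      have : 0 < 1 / a ^ 2 := by positivity
      linarith
    refine ⟨?_, fun h => absurd h hx⟩
    simp [bzDens, hx, h0]
  · have hd' : 0 < d.toReal := ENNReal.toReal_pos h0 hdt.ne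
    set s := 1 / √d.toReal with hs
    have s0 : 0 < s := by positivity
    have hsd : 1 / s ^ 2 = d.toReal := by
      rw [hs, div_pow, Real.sq_sqrt hd'.le]; simp
    have m1 : ∀ a, s < a → (x, a) ∈ bzE μ := by
      intro a ha
      apply bz_mem_of_lt hd (s0.trans ha)
      rw [ENNReal.ofReal_lt_iff_lt_toReal (by positivity) hdt.ne, ← hsd]
      gcongr
    have m2 : ∀ a, (x, a) ∈ bzE μ → s ≤ a := by
      intro a ha
      have h1 := bz_le_of_mem hd ha
      have ha0 : 0 < a := ha.1
      rw [ENNReal.ofReal_le_iff_le_toReal hdt.ne, ← hsd] at h1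
      by_contra hc
      have : 1 / s ^ 2 < 1 / a ^ 2 := by gcongr; linarith
      linarith
    have hxD : x ∈ bzD μ := ⟨s + 1, m1 _ (by linarith)⟩
    have hphi : bzPhi μ x = s := by
      apply le_antisymm
      · apply le_of_forall_pos_le_add
        intro ε hε
        exact csInf_le (bz_bddBelow x) (m1 _ (by linarith))
      · exact le_csInf hxD m2
    refine ⟨?_, fun _ => by rw [hphi]; exact s0⟩
    simp only [bzDens, hxD, if_true, hphi, hsd]
    exact ENNReal.ofReal_toReal hdt.ne

lemma bz_ae_vol [IsFiniteMeasure μ] : ∀ᵐ x ∂(volume : Measure (ℝ × ℝ)),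
    ENNReal.ofReal (bzDens (bzD μ) (bzPhi μ) x) = μ.rnDeriv volume x ∧
      (x ∈ bzD μ → 0 < bzPhi μ x) := by
  filter_upwards [Besicovitch.ae_tendsto_rnDeriv μ volume, Measure.rnDeriv_lt_top μ volume]
    with x h1 h2
  exact bz_dens_eq h1 h2

lemma bz_ae_mu [IsFiniteMeasure μ] : ∀ᵐ x ∂μ, x ∈ bzD μ ∧
    (0 < bzPhi μ x → (volume : Measure (ℝ × ℝ)).rnDeriv μ x ≠ 0) := by
  filter_upwards [Besicovitch.ae_tendsto_rnDeriv volume μ,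
    Measure.rnDeriv_lt_top (volume : Measure (ℝ × ℝ)) μ] with x h1 h2
  set ψ := (volume : Measure (ℝ × ℝ)).rnDeriv μ x
  have hd : Tendsto (fun r => μ (closedBall x r) / volume (closedBall x r)) (𝓝[>] 0) (𝓝 ψ⁻¹) := by
    have := ((continuous_inv (G := ℝ≥0∞)).tendsto ψ).comp h1
    refine this.congr' ?_
    filter_upwards [self_mem_nhdsWithin] with r hr
    have hr : 0 < r := hr
    simp only [Function.comp]
    rw [ENNReal.inv_div]
    · right; rw [bz_vol_ball x hr.le]; exact ENNReal.ofReal_ne_top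
    · right; rw [bz_vol_ball x hr.le]; exact (ENNReal.ofReal_pos.2 (by positivity)).ne'
  constructor
  · have hpos : 0 < ψ⁻¹ := ENNReal.inv_pos.2 h2.ne
    obtain ⟨q, hq0, hq⟩ := ENNReal.lt_iff_exists_nnreal_btwn.1 hpos
    have hq0' : 0 < (q : ℝ) := by exact_mod_cast hq0
    refine ⟨1 / √q, bz_mem_of_lt hd (by positivity) ?_⟩
    rw [div_pow, Real.sq_sqrt hq0'.le]
    simpa using hq
  · intro hp h0
    rw [h0, ENNReal.inv_zero] at hd
    have : {a | (x, a) ∈ bzE μ} = Ioi 0 := by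
      ext a
      exact ⟨fun h => h.1, fun h => bz_mem_of_lt hd h ENNReal.ofReal_lt_top⟩
    unfold bzPhi at hp
    rw [this, csInf_Ioi] at hp
    exact lt_irrefl _ hp

lemma bz_interior [IsFiniteMeasure μ] (hc : Convex ℝ (bzD μ))
    (hsupp : (interior {x : ℝ × ℝ | ∀ U ∈ nhds x, 0 < μ U}).Nonempty) :
    (interior (bzD μ)).Nonempty := by
  rw [hc.interior_nonempty_iff_affineSpan_eq_top]
  have hnull : μ (bzD μ)ᶜ = 0 := by
    have := (bz_ae_mu (μ := μ)).mono (fun x hx => hx.1)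
    exact ae_iff.1 this
  have hsub : interior {x : ℝ × ℝ | ∀ U ∈ nhds x, 0 < μ U} ⊆ (affineSpan ℝ (bzD μ) : Set (ℝ × ℝ)) := by
    intro x hx
    have hx := interior_subset hx
    have hcl : x ∈ closure (bzD μ) := by
      rw [mem_closure_iff_nhds]
      intro U hU
      by_contra hne
      have h1 : U ⊆ (bzD μ)ᶜ := by
        intro z hz hzD
        exact hne ⟨z, hz, hzD⟩
      have := hx U hU
      rw [measure_mono_null h1 hnull] at this
      exact lt_irrefl _ this
    have hclosed : IsClosed (affineSpan ℝ (bzD μ) : Set (ℝ × ℝ)) :=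
      AffineSubspace.closed_of_finiteDimensional _
    exact closure_minimal (subset_affineSpan ℝ _) hclosed hcl
  have h2 := isOpen_interior.affineSpan_eq_top hsupp
  rw [eq_top_iff, ← h2]
  exact affineSpan_le.2 hsub

lemma bz_conv [IsProbabilityMeasure μ] (hsymm : Measure.map (fun z : ℝ × ℝ => -z) μ = μ)
    (hq : ∀ A B : Set (ℝ × ℝ), MeasurableSet A → MeasurableSet B → ∀ t : ℝ,
      t ∈ Icc (0:ℝ) 1 → min (μ A) (μ B) ≤ μ ((1 - t) • A + t • B))
    (hsupp : (interior {x : ℝ × ℝ | ∀ U ∈ nhds x, 0 < μ U}).Nonempty) :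
    BzConv (bzD μ) (bzPhi μ) ∧
      μ = volume.withDensity (fun z => ENNReal.ofReal (bzDens (bzD μ) (bzPhi μ) z)) := by
  have hconv := bz_convexOn (bzE_convex hq)
  have hnegD : ∀ x ∈ bzD μ, -x ∈ bzD μ := fun x ⟨a, ha⟩ => ⟨a, (bzE_neg hsymm x a).2 ha⟩
  have heven : ∀ x, bzPhi μ (-x) = bzPhi μ x := by
    intro x
    simp only [bzPhi, bzE_neg hsymm]
  have h0 : (0 : ℝ × ℝ) ∈ interior (bzD μ) := by
    obtain ⟨x, hx⟩ := bz_interior hconv.1 hsupp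
    have hneg : -bzD μ = bzD μ := by
      ext z
      exact ⟨fun hz => by simpa using hnegD _ hz, fun hz => hnegD _ hz⟩
    have hx' : -x ∈ interior (bzD μ) := by
      have h1 : -interior (bzD μ) ⊆ interior (bzD μ) := by
        apply interior_maximal
        · intro z hz
          rw [← hneg]
          exact interior_subset (s := bzD μ) hz
        · exact isOpen_interior.neg
      exact h1 (by simpa using hx)
    have := hconv.1.interior hx hx' (show (0:ℝ) ≤ 1/2 by norm_num)
      (show (0:ℝ) ≤ 1/2 by norm_num) (by norm_num)
    simpa using this
  have hbdd : ∃ η > 0, ∀ q : ℝ × ℝ, ‖q‖ ≤ η → q ∈ bzD μ ∧ bzPhi μ q ≤ bzPhi μ 0 + 1 := by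
    have hca : ContinuousAt (bzPhi μ) 0 :=
      hconv.continuousOn_interior.continuousAt (isOpen_interior.mem_nhds h0)
    have h1 : ∀ᶠ q in 𝓝 (0 : ℝ × ℝ), bzPhi μ q < bzPhi μ 0 + 1 :=
      hca.eventually (gt_mem_nhds (by linarith))
    have h2 : ∀ᶠ q in 𝓝 (0 : ℝ × ℝ), q ∈ bzD μ := mem_interior_iff_mem_nhds.1 h0
    obtain ⟨η, hη, hb⟩ := nhds_basis_closedBall.eventually_iff.1 (h1.and h2)
    refine ⟨η, hη, fun q hq => ?_⟩
    have := hb (by simpa using hq)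
    exact ⟨this.2, this.1.le⟩
  obtain ⟨η, hη, hb⟩ := hbdd
  have hpos : 0 < bzPhi μ 0 := by
    refine lt_of_le_of_ne (bzPhi_nonneg 0) ?_
    intro hz
    rw [← hz, zero_add] at hb
    have hlow : ∀ l : ℝ, 0 < l → l ≤ 1 → ENNReal.ofReal (4 * η ^ 2) ≤
        ∫⁻ x in closedBall (0 : ℝ × ℝ) (l * η), μ.rnDeriv volume x := by
      intro l hl hl1
      have e1 : ENNReal.ofReal (4 * η ^ 2) =
          ∫⁻ x in closedBall (0 : ℝ × ℝ) (l * η), ENNReal.ofReal (1 / l ^ 2) := by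
        rw [setLIntegral_const, bz_vol_ball 0 (by positivity), ← ENNReal.ofReal_mul (by positivity)]
        congr 1; field_simp
      rw [e1]
      apply setLIntegral_mono_ae' measurableSet_closedBall
      filter_upwards [bz_ae_vol (μ := μ)] with x hx hxb
      rw [← hx.1]
      apply ENNReal.ofReal_le_ofReal
      have hxb' : ‖x‖ ≤ l * η := by simpa using hxb
      have hy := hb (l⁻¹ • x) (by
        rw [norm_smul, Real.norm_of_nonneg (by positivity), inv_mul_le_iff₀ hl]; exact hxb')
      have hzD : (0 : ℝ × ℝ) ∈ bzD μ := interior_subset h0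
      have e2 : l • (l⁻¹ • x) + (1 - l) • (0 : ℝ × ℝ) = x := by
        rw [smul_zero, add_zero, smul_smul, mul_inv_cancel₀ hl.ne', one_smul]
      have hxD := hconv.1 hy.1 hzD hl.le (by linarith : (0:ℝ) ≤ 1 - l) (by ring)
      have hxl := hconv.2 hy.1 hzD hl.le (by linarith : (0:ℝ) ≤ 1 - l) (by ring)
      rw [e2] at hxD hxl
      rw [← hz] at hxl
      simp only [smul_eq_mul, mul_zero, add_zero] at hxl
      have hpx := hx.2 hxD
      simp only [bzDens, hxD, if_true]
      have : bzPhi μ x ≤ l := by nlinarith [hy.2]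
      gcongr
    have ht : Tendsto (fun l : ℝ => ∫⁻ x in closedBall (0 : ℝ × ℝ) (l * η), μ.rnDeriv volume x)
        (𝓝[>] 0) (𝓝 0) := by
      apply tendsto_setLIntegral_zero (Measure.lintegral_rnDeriv_lt_top μ volume).ne
      have h1 : Tendsto (fun l : ℝ => ENNReal.ofReal (4 * (l * η) ^ 2)) (𝓝[>] 0) (𝓝 0) := by
        have : Tendsto (fun l : ℝ => ENNReal.ofReal (4 * (l * η) ^ 2)) (𝓝 0)
            (𝓝 (ENNReal.ofReal (4 * (0 * η) ^ 2))) := by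
          apply ENNReal.tendsto_ofReal
          apply Continuous.tendsto (f := fun l : ℝ => 4 * (l * η) ^ 2)
          fun_prop
        simp only [zero_mul, ne_eq, OfNat.ofNat_ne_zero, not_false_eq_true, zero_pow, mul_zero,
          ENNReal.ofReal_zero] at this
        exact this.mono_left nhdsWithin_le_nhds
      refine h1.congr' ?_
      filter_upwards [self_mem_nhdsWithin] with l hl
      have hl : 0 < l := hl
      exact (bz_vol_ball 0 (by positivity)).symm
    have h2 : ENNReal.ofReal (4 * η ^ 2) ≤ 0 := by
      apply ge_of_tendsto ht
      filter_upwards [Ioo_mem_nhdsGT (show (0:ℝ) < 1 by norm_num)] with l hl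
      exact hlow l hl.1 hl.2.le
    simp only [nonpos_iff_eq_zero, ENNReal.ofReal_eq_zero] at h2
    have : 0 < 4 * η ^ 2 := by positivity
    linarith
  have hB : BzConv (bzD μ) (bzPhi μ) := ⟨hconv, hnegD, heven, hpos, η, hη, _, hb⟩
  refine ⟨hB, ?_⟩
  have hac : μ ≪ volume := by
    apply Measure.AbsolutelyContinuous.mk
    intro s hs hs0
    have h1 := Measure.setLIntegral_rnDeriv_le (μ := (volume : Measure (ℝ × ℝ))) (ν := μ) s
    rw [hs0, nonpos_iff_eq_zero, lintegral_eq_zero_iff (Measure.measurable_rnDeriv _ _)] at h1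
    have h2 : ∀ᵐ x ∂(μ.restrict s), False := by
      filter_upwards [h1, ae_restrict_of_ae (bz_ae_mu (μ := μ))] with x hx1 hx2
      exact hx2.2 (hB.phi_pos hx2.1) hx1
    have h3 : μ.restrict s = 0 := by
      rw [← ae_eq_bot]
      exact Filter.eventually_false_iff_eq_bot.1 h2
    exact Measure.restrict_eq_zero.1 h3
  conv_lhs => rw [← Measure.withDensity_rnDeriv_eq μ volume hac]
  apply withDensity_congr_ae
  filter_upwards [bz_ae_vol (μ := μ)] with x hx
  exact hx.1.symm

end PartD

section PartE
open Set Filter Topology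

variable {D : Set (ℝ × ℝ)} {φ : ℝ × ℝ → ℝ}

lemma bz_min_le_genMean (κ : EReal) (t a b : ℝ) (ht : t ∈ Icc (0:ℝ) 1) (ha : 0 ≤ a) (hb : 0 ≤ b) :
    min a b ≤ genMean κ t a b := by
  obtain ⟨t0, t1⟩ := ht
  have t1' : 0 ≤ 1 - t := by linarith
  have hm : 0 ≤ min a b := le_min ha hb
  have hma : min a b ≤ a := min_le_left _ _
  have hmb : min a b ≤ b := min_le_right _ _
  unfold genMean
  split_ifs with h1 h2 h3 h4
  · exact le_rfl
  · exact min_le_max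
  · calc min a b = (min a b) ^ (1 - t) * (min a b) ^ t := by
          rw [← Real.rpow_add_of_nonneg hm t1' t0]; simp
      _ ≤ _ := by gcongr
  · rcases h4.2 with h | h
    · exact h ▸ hma
    · exact h ▸ hmb
  · have hk : κ.toReal ≠ 0 := by
      intro h
      rcases EReal.toReal_eq_zero_iff.1 h with h | h | h
      · exact h3 h
      · exact h2 h
      · exact h1 h
    generalize κ.toReal = k at *
    rcases lt_or_gt_of_ne hk with hk | hk
    · have h5 : ¬ (a = 0 ∨ b = 0) := fun h => h4 ⟨hk, h⟩
      push Not at h5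
      have a0 : 0 < a := lt_of_le_of_ne ha (Ne.symm h5.1)
      have b0 : 0 < b := lt_of_le_of_ne hb (Ne.symm h5.2)
      have m0 : 0 < min a b := lt_min a0 b0
      have ea : a ^ k ≤ (min a b) ^ k := Real.rpow_le_rpow_of_nonpos m0 hma hk.le
      have eb : b ^ k ≤ (min a b) ^ k := Real.rpow_le_rpow_of_nonpos m0 hmb hk.le
      have hle : (1 - t) * a ^ k + t * b ^ k ≤ (min a b) ^ k := by nlinarith
      have pa : 0 < a ^ k := Real.rpow_pos_of_pos a0 k
      have pb : 0 < b ^ k := Real.rpow_pos_of_pos b0 k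
      have hpos : 0 < (1 - t) * a ^ k + t * b ^ k := by
        rcases eq_or_lt_of_le t0 with h | h
        · rw [← h]; simpa using pa
        · have := mul_pos h pb
          have := mul_nonneg t1' pa.le
          linarith
      have h6 := Real.rpow_le_rpow_of_nonpos hpos hle (z := 1 / k) (one_div_nonpos.2 hk.le)
      rwa [← Real.rpow_mul hm, mul_one_div_cancel hk.ne, Real.rpow_one] at h6
    · have ea : (min a b) ^ k ≤ a ^ k := by gcongr
      have eb : (min a b) ^ k ≤ b ^ k := by gcongr
      have hle : (min a b) ^ k ≤ (1 - t) * a ^ k + t * b ^ k := by nlinarith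
      have h6 := Real.rpow_le_rpow (Real.rpow_nonneg hm k) hle (z := 1 / k) (by positivity)
      rwa [← Real.rpow_mul hm, mul_one_div_cancel hk.ne', Real.rpow_one] at h6

lemma BzConv.comp (h : BzConv D φ) (T : (ℝ × ℝ) →L[ℝ] (ℝ × ℝ)) : BzConv (T ⁻¹' D) (φ ∘ T) where
  conv := h.conv.comp_linearMap T.toLinearMap
  negD := fun x hx => by
    change T (-x) ∈ D
    rw [map_neg]; exact h.negD _ hx
  even := fun x => by simp [h.even]
  pos := by simpa using h.pos
  bdd := by
    obtain ⟨η, h0, M, hM⟩ := h.bdd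
    refine ⟨η / (‖T‖ + 1), by positivity, M, fun q hq => hM (T q) ?_⟩
    rw [le_div_iff₀ (by positivity)] at hq
    have := T.le_opNorm q
    nlinarith [norm_nonneg q, norm_nonneg T]

lemma BzConv.marginal_comp (h : BzConv D φ)
    (hm : AEMeasurable (fun z => ENNReal.ofReal (bzDens D φ z)) volume)
    (h1 : ∫⁻ z, ENNReal.ofReal (bzDens D φ z) = 1)
    (T : (ℝ × ℝ) →L[ℝ] (ℝ × ℝ)) (E : (ℝ × ℝ) ≃ᵐ (ℝ × ℝ)) (hTE : ∀ z, E.symm z = T z)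
    (hE : MeasurePreserving E volume volume)
    (u : ℝ → ℝ) (mu : Measurable u) (nu : ∀ x, 0 ≤ u x)
    (hu : (volume.withDensity (fun z => ENNReal.ofReal (bzDens D φ z))).map (Prod.fst ∘ E)
      = volume.withDensity (fun x => ENNReal.ofReal (u x))) :
    eLpNorm u ⊤ volume = ∫⁻ r : ℝ, ENNReal.ofReal (bzDens D φ (T (0, r))) ∧
      ∫⁻ r : ℝ, ENNReal.ofReal (bzDens D φ (T (0, r))) ≠ ⊤ ∧
      ∫⁻ r : ℝ, ENNReal.ofReal (bzDens D φ (T (0, r))) ≠ 0 := by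
  have e : ∀ z, bzDens (T ⁻¹' D) (φ ∘ T) z = bzDens D φ (E.symm z) := by
    intro z; rw [hTE]; rfl
  have hwd : Measure.map E (volume.withDensity (fun z => ENNReal.ofReal (bzDens D φ z)))
      = volume.withDensity (fun z => ENNReal.ofReal (bzDens (T ⁻¹' D) (φ ∘ T) z)) := by
    ext s hs
    rw [Measure.map_apply E.measurable hs, withDensity_apply _ (E.measurable hs),
      withDensity_apply _ hs]
    have := hE.setLIntegral_comp_preimage_emb E.measurableEmbedding
      (fun z => ENNReal.ofReal (bzDens (T ⁻¹' D) (φ ∘ T) z)) s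
    rw [← this]
    simp [e]
  refine (h.comp T).marginal ?_ ?_ u mu nu ?_
  · simp_rw [e]
    exact hm.comp_quasiMeasurePreserving (hE.symm E).quasiMeasurePreserving
  · rw [← h1]
    simp_rw [e]
    exact (hE.symm E).lintegral_comp_emb E.symm.measurableEmbedding
      (fun z => ENNReal.ofReal (bzDens D φ z))
  · rw [← hu, ← hwd, Measure.map_map measurable_fst E.measurable]

def bzTv : (ℝ × ℝ) →L[ℝ] (ℝ × ℝ) :=
  (ContinuousLinearMap.snd ℝ ℝ ℝ).prod (ContinuousLinearMap.fst ℝ ℝ ℝ)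

def bzTw : (ℝ × ℝ) →L[ℝ] (ℝ × ℝ) :=
  (ContinuousLinearMap.snd ℝ ℝ ℝ).prod
    (ContinuousLinearMap.fst ℝ ℝ ℝ - ContinuousLinearMap.snd ℝ ℝ ℝ)

def bzEv : (ℝ × ℝ) ≃ᵐ (ℝ × ℝ) where
  toFun z := (z.2, z.1)
  invFun z := (z.2, z.1)
  left_inv z := rfl
  right_inv z := rfl
  measurable_toFun := by
    change Measurable fun z : ℝ × ℝ => (z.2, z.1)
    fun_prop
  measurable_invFun := by
    change Measurable fun z : ℝ × ℝ => (z.2, z.1)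
    fun_prop

def bzEw : (ℝ × ℝ) ≃ᵐ (ℝ × ℝ) where
  toFun z := (z.1 + z.2, z.1)
  invFun z := (z.2, z.1 - z.2)
  left_inv z := by ext <;> simp
  right_inv z := by ext <;> simp
  measurable_toFun := by
    change Measurable fun z : ℝ × ℝ => (z.1 + z.2, z.1)
    fun_prop
  measurable_invFun := by
    change Measurable fun z : ℝ × ℝ => (z.2, z.1 - z.2)
    fun_prop

lemma bzEv_mp : MeasurePreserving bzEv volume volume := by
  rw [Measure.volume_eq_prod]
  exact Measure.measurePreserving_swap

lemma bzEw_mp : MeasurePreserving bzEw volume volume := by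
  rw [Measure.volume_eq_prod]
  exact Measure.measurePreserving_swap.comp
    (measurePreserving_prod_add (volume : Measure ℝ) (volume : Measure ℝ))

end PartE

/-- Busemann-type theorem for convex measures: if `(U,V)` is a random vector in `ℝ²`
whose distribution is symmetric and `κ`-concave with `κ ∈ [-∞, 1/2]`, and has a
density, then `exp(h_∞(U+V)) ≤ exp(h_∞(U)) + exp(h_∞(V))` (equivalently
`1/‖w‖_∞ ≤ 1/‖u‖_∞ + 1/‖v‖_∞` for the densities `w, u, v` of `U+V, U, V`). -/
theorem busemann_convex_measures_dim2 {Ω : Type*} [MeasurableSpace Ω]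
    (P : Measure Ω) [IsProbabilityMeasure P]
    (κ : EReal) (hκ : κ ≤ ((1 / 2 : ℝ) : EReal))
    (W : Ω → ℝ × ℝ) (hW : Measurable W)
    (hsymm : Measure.map (fun z : ℝ × ℝ => -z) (Measure.map W P) = Measure.map W P)
    (hconc : IsKappaConcave κ (Measure.map W P))
    (u v w : ℝ → ℝ)
    (hu : HasDensityFn1 P (fun ω => (W ω).1) u)
    (hv : HasDensityFn1 P (fun ω => (W ω).2) v)
    (hw : HasDensityFn1 P (fun ω => (W ω).1 + (W ω).2) w) :
    Real.exp (supEntropy1 w) ≤ Real.exp (supEntropy1 u) + Real.exp (supEntropy1 v) := by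
  set μ := Measure.map W P with hμ
  have : IsProbabilityMeasure μ := Measure.isProbabilityMeasure_map hW.aemeasurable
  obtain ⟨hsupp, hconc⟩ := hconc
  have hq : ∀ A B : Set (ℝ × ℝ), MeasurableSet A → MeasurableSet B → ∀ t : ℝ,
      t ∈ Set.Icc (0:ℝ) 1 → min (μ A) (μ B) ≤ μ ((1 - t) • A + t • B) := by
    intro A B hA hB t ht
    have h1 := (bz_min_le_genMean κ t _ _ ht ENNReal.toReal_nonneg ENNReal.toReal_nonneg).trans
      (hconc A B hA hB t ht)
    rw [← ENNReal.toReal_min (measure_ne_top _ _) (measure_ne_top _ _)] at h1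
    exact (ENNReal.toReal_le_toReal (ne_top_of_le_ne_top (measure_ne_top μ A) (min_le_left _ _))
      (measure_ne_top _ _)).1 h1
  obtain ⟨hB, hμd⟩ := bz_conv hsymm hq hsupp
  set D := bzD μ
  set φ := bzPhi μ
  have hm : AEMeasurable (fun z => ENNReal.ofReal (bzDens D φ z)) volume :=
    (Measure.measurable_rnDeriv μ volume).aemeasurable.congr
      ((bz_ae_vol (μ := μ)).mono fun x hx => hx.1.symm)
  have h1 : ∫⁻ z, ENNReal.ofReal (bzDens D φ z) = 1 := by
    have h2 : μ Set.univ = 1 := measure_univ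
    rw [hμd, withDensity_apply _ MeasurableSet.univ, Measure.restrict_univ] at h2
    exact h2
  obtain ⟨_, mu, nu, du⟩ := hu
  obtain ⟨_, mv, nv, dv⟩ := hv
  obtain ⟨_, mw, nw, dw⟩ := hw
  have Hu := hB.marginal hm h1 u mu nu (by
    rw [← hμd, hμ, Measure.map_map measurable_fst hW]; exact du)
  have Hv := hB.marginal_comp hm h1 bzTv bzEv (fun z => rfl) bzEv_mp v mv nv (by
    rw [← hμd, hμ, Measure.map_map (measurable_fst.comp bzEv.measurable) hW]; exact dv)
  have Hw := hB.marginal_comp hm h1 bzTw bzEw (fun z => rfl) bzEw_mp w mw nw (by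
    rw [← hμd, hμ, Measure.map_map (measurable_fst.comp bzEw.measurable) hW]; exact dw)
  have eu : bzI D φ 0 = ∫⁻ r : ℝ, ENNReal.ofReal (bzDens D φ (r • ((0:ℝ), (-1:ℝ)))) := by
    unfold bzI
    congr 1; ext r
    rw [← hB.dens_neg (0, r)]
    simp
  have ev : ∫⁻ r : ℝ, ENNReal.ofReal (bzDens D φ (bzTv (0, r)))
      = ∫⁻ r : ℝ, ENNReal.ofReal (bzDens D φ (r • ((1:ℝ), (0:ℝ)))) := by
    congr 1; ext r
    simp [bzTv]
  have ew : ∫⁻ r : ℝ, ENNReal.ofReal (bzDens D φ (bzTw (0, r)))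
      = ∫⁻ r : ℝ, ENNReal.ofReal (bzDens D φ (r • (((1:ℝ), (0:ℝ)) + ((0:ℝ), (-1:ℝ))))) := by
    congr 1; ext r
    simp [bzTw]
  rw [eu] at Hu
  rw [ev] at Hv
  rw [ew] at Hw
  have key := hB.busemann _ _ Hv.2.1 Hu.2.1 Hw.2.1
  unfold supEntropy1
  rw [Hu.1, Hv.1, Hw.1]
  have pu := ENNReal.toReal_pos Hu.2.2 Hu.2.1
  have pv := ENNReal.toReal_pos Hv.2.2 Hv.2.1
  have pw := ENNReal.toReal_pos Hw.2.2 Hw.2.1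
  rw [Real.exp_neg, Real.exp_neg, Real.exp_neg, Real.exp_log pu, Real.exp_log pv, Real.exp_log pw]
  rw [inv_add_inv pu.ne' pv.ne', inv_le_comm₀ pw (by positivity), inv_div,
    div_le_iff₀ (by positivity)]
  linarith
end
end
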